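/- Let G be a canonical plumbing graph containing none of the seventeen forbidden configurations as an induced subgraph. Then the dual Γ of G satisfies the Working Conditions. -/

import Mathlib

namespace LensPaper

/-- A finite weighted simple graph: the combinatorial data underlying a configuration
(a disjoint union of weighted linear graphs).  The fact that every connected component
is a path is recorded separately by `Config.IsLinear`. -/
structure Config where
  V : Type
  fin : Fintype V
  deq : DecidableEq V
  graph : SimpleGraph V
  adjDec : DecidableRel graph.Adj
  w : V → ℤ

attribute [instance] Config.fin Config.deq Config.adjDec

namespace Config

/-- The degree of a vertex. -/
noncomputable def deg (C : Config) (v : C.V) : ℕ := (C.graph.neighborSet v).ncard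

/-- A configuration: every component is a path, i.e. all degrees are at most `2` and the
graph is acyclic. -/
def IsLinear (C : Config) : Prop :=
  (∀ v : C.V, C.deg v ≤ 2) ∧ C.graph.IsAcyclic

/-- The adjusted weight `w'(v) = w(v) - deg(v)`. -/
noncomputable def adjw (C : Config) (v : C.V) : ℤ := C.w v - C.deg v

/-- A vertex is bad if it is adjacent to two distinct vertices of positive adjusted
weight. -/
def IsBad (C : Config) (x : C.V) : Prop :=
  ∃ u v : C.V, u ≠ v ∧ C.graph.Adj x u ∧ C.graph.Adj x v ∧ 0 < C.adjw u ∧ 0 < C.adjw v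

/-- A leaf: a vertex of degree at most one. -/
def IsLeaf (C : Config) (v : C.V) : Prop := C.deg v ≤ 1

/-- `v 0, v 1, …, v m` is a chain of consecutive (distinct) vertices. -/
def IsChain (C : Config) (m : ℕ) (v : ℕ → C.V) : Prop :=
  (∀ i ≤ m, ∀ j ≤ m, v i = v j → i = j) ∧ ∀ i < m, C.graph.Adj (v i) (v (i + 1))

/-- The chain `v 0, …, v m` has the list `p` as its sequence of adjusted weights. -/
def ChainPattern (C : Config) (m : ℕ) (v : ℕ → C.V) (p : List ℤ) : Prop :=
  C.IsChain m v ∧ m + 1 = p.length ∧ ∀ i : Fin p.length, C.adjw (v i) = p.get i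

/-- `Γ` contains a chain of consecutive vertices whose adjusted weights, read in order,
form the list `p`. -/
def HasPattern (C : Config) (p : List ℤ) : Prop := ∃ m v, C.ChainPattern m v p

/-- A chain realizing a bad-part pattern `p` (each entry of `p` is an adjusted weight
together with a flag marking the bad positions): the chain has the prescribed adjusted
weights, and the bad vertices of the configuration are exactly the vertices of the chain
in the flagged positions. -/
def IsBadPartChain (C : Config) (p : List (ℤ × Bool)) (m : ℕ) (v : ℕ → C.V) : Prop :=
  C.IsChain m v ∧ m + 1 = p.length ∧
  (∀ i : Fin p.length, C.adjw (v i) = (p.get i).1) ∧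
  (∀ x : C.V, C.IsBad x ↔ ∃ i : Fin p.length, (p.get i).2 = true ∧ v i = x)

end Config

/-- The chains of adjusted weights forbidden by Working Condition VI. -/
def forbiddenPatterns : List (List ℤ) :=
  [[1, 0, 0, 2], [1, 0, 0, 3], [1, 0, 0, 0, 3], [1, 1, 0, 0, 1, 2], [3, 1, 0, 0, 1],
   [1, 0, 1, 2], [1, 0, 1, 3], [1, 1, 0, 2], [1, 1, 0, 1, 1, 2]]

/-- The bad-part patterns of Working Condition VII; `true` marks the bad positions. -/
def badPatterns : List (List (ℤ × Bool)) :=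
  [[(1, false), (0, true), (1, false)],
   [(1, false), (0, true), (2, false)],
   [(1, false), (0, true), (3, false)],
   [(1, false), (1, true), (1, false)],
   [(1, false), (1, true), (2, false)],
   [(1, false), (2, true), (1, false)],
   [(1, false), (0, true), (1, false), (0, true), (1, false)],
   [(1, false), (0, true), (1, false), (0, true), (2, false)],
   [(1, false), (0, true), (1, false), (1, true), (1, false)],
   [(1, false), (0, true), (1, false), (1, true), (2, false)],
   [(1, false), (1, true), (1, true), (1, false)],
   [(1, false), (1, true), (1, true), (1, true), (1, false)],
   [(1, false), (1, true), (2, true), (1, false)]]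

namespace Config

/-- The Working Conditions (I)–(VII). -/
def WorkingConditions (C : Config) : Prop :=
  (∀ v : C.V, 2 ≤ C.w v) ∧
  (∀ v : C.V, C.adjw v ≤ 3) ∧
  (∀ u v : C.V, 1 < C.adjw u → 1 < C.adjw v → u = v) ∧
  (∀ v x : C.V, 1 < C.adjw v → C.IsBad x → C.adjw x = 1 → C.graph.Adj x v) ∧
  ((∃ v : C.V, C.adjw v = 3) →
     ∀ u u' : C.V, C.graph.Adj u u' → C.adjw u = 1 → C.adjw u' = 1 → False) ∧
  (∀ u v x : C.V, C.graph.Adj u v → C.adjw u = 1 → C.adjw v = 1 →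
     C.IsBad x → C.adjw x = 2 → C.graph.Adj x u ∨ C.graph.Adj x v) ∧
  (∀ p ∈ forbiddenPatterns, ¬ C.HasPattern p) ∧
  ((∃ x : C.V, C.IsBad x) → ∃ p ∈ badPatterns, ∃ m v, C.IsBadPartChain p m v)

end Config

/-- The standard inner product on `ℤ^N`. -/
def dot {N : ℕ} (x y : Fin N → ℤ) : ℤ := ∑ i, x i * y i

/-- The support of a vector of `ℤ^N` with respect to the standard orthonormal basis. -/
def supp {N : ℕ} (x : Fin N → ℤ) : Finset (Fin N) :=
  Finset.univ.filter fun i => x i ≠ 0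

namespace Config

/-- An embedding of a configuration into `ℤ^N`. -/
def IsEmbedding (C : Config) (N : ℕ) (φ : C.V → Fin N → ℤ) : Prop :=
  ∀ u v : C.V, dot (φ u) (φ v) =
    if u = v then C.w u else if C.graph.Adj u v then -1 else 0

/-- The restriction of `φ` to `S` is standard. -/
def IsStandardOn (C : Config) (N : ℕ) (φ : C.V → Fin N → ℤ) (S : Set C.V) : Prop :=
  ∀ u ∈ S, ∀ v ∈ S,
    ((supp (φ u) ∩ supp (φ v)).card : ℤ) =
      if u = v then C.w v else if C.graph.Adj u v then 1 else 0

/-- A standard embedding. -/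
def IsStandard (C : Config) (N : ℕ) (φ : C.V → Fin N → ℤ) : Prop :=
  C.IsStandardOn N φ Set.univ

/-- The restriction of `φ` to `S` is semi-standard at `x`. -/
def IsSemiStandardAtOn (C : Config) (N : ℕ) (φ : C.V → Fin N → ℤ) (x : C.V)
    (S : Set C.V) : Prop :=
  (∀ u ∈ S, ∀ v ∈ S,
    ((supp (φ u) ∩ supp (φ v)).card : ℤ) =
      if u = v then C.w v
      else if C.graph.Adj u v then 1
      else if C.graph.Adj x u ∧ C.graph.Adj x v then 2
      else 0) ∧
  (∀ u ∈ S, ∀ v ∈ S, u ≠ v → C.graph.Adj x u → C.graph.Adj x v →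
    (supp (φ u) ∩ supp (φ x) ∩ supp (φ v)).card = 1)

/-- A semi-standard embedding: semi-standard at some bad vertex. -/
def IsSemiStandard (C : Config) (N : ℕ) (φ : C.V → Fin N → ℤ) : Prop :=
  ∃ x : C.V, C.IsBad x ∧ C.IsSemiStandardAtOn N φ x Set.univ

/-- A candidate for the extended bad part: a chain containing the bad part whose two
ends are either leaves or preceded by two consecutive vertices of vanishing adjusted
weight. -/
def IsEBPCand (C : Config) (m : ℕ) (v : ℕ → C.V) : Prop :=
  C.IsChain m v ∧
  (∀ p ∈ badPatterns, ∀ mb vb, C.IsBadPartChain p mb vb →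
     ∀ i ≤ mb, ∃ j ≤ m, v j = vb i) ∧
  (C.IsLeaf (v 0) ∨ (2 ≤ m ∧ C.adjw (v 1) = 0 ∧ C.adjw (v 2) = 0)) ∧
  (C.IsLeaf (v m) ∨ (2 ≤ m ∧ C.adjw (v (m - 1)) = 0 ∧ C.adjw (v (m - 2)) = 0))

/-- The extended bad part: a candidate with the fewest vertices. -/
def IsExtBadPart (C : Config) (m : ℕ) (v : ℕ → C.V) : Prop :=
  C.IsEBPCand m v ∧ ∀ m' v', C.IsEBPCand m' v' → m ≤ m'

/-- The set of vertices of the chain `v 0, …, v m`. -/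
def ebpSet (C : Config) (m : ℕ) (v : ℕ → C.V) : Set C.V := {y | ∃ i ≤ m, v i = y}

/-- The outside part of `Γ` relative to the extended bad part `v 0, …, v m`. -/
def OutsidePart (C : Config) (m : ℕ) (v : ℕ → C.V) : Set C.V :=
  {x | ∀ i ≤ m, v i ≠ x}
  ∪ {x | ¬ C.IsLeaf (v 0) ∧ (x = v 0 ∨ x = v 1 ∨ x = v 2)}
  ∪ {x | ¬ C.IsLeaf (v m) ∧ (x = v m ∨ x = v (m - 1) ∨ x = v (m - 2))}

/-- A screw at the front end of the extended bad part. -/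
def IsFrontScrew (C : Config) (N : ℕ) (φ : C.V → Fin N → ℤ) (m : ℕ) (v : ℕ → C.V)
    (e : Fin N) : Prop :=
  ¬ C.IsLeaf (v 0) ∧ 3 ≤ m ∧ φ (v 2) e ≠ 0 ∧ φ (v 3) e ≠ 0

/-- A screw at the back end of the extended bad part. -/
def IsBackScrew (C : Config) (N : ℕ) (φ : C.V → Fin N → ℤ) (m : ℕ) (v : ℕ → C.V)
    (e : Fin N) : Prop :=
  ¬ C.IsLeaf (v m) ∧ 3 ≤ m ∧ φ (v (m - 2)) e ≠ 0 ∧ φ (v (m - 3)) e ≠ 0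

/-- All screws of `Γ` (with respect to `φ`) are clean. -/
def AllScrewsClean (C : Config) (N : ℕ) (φ : C.V → Fin N → ℤ) (m : ℕ)
    (v : ℕ → C.V) : Prop :=
  (∀ e : Fin N, C.IsFrontScrew N φ m v e →
    ∀ u : C.V, u ≠ v 2 → u ≠ v 3 → φ u e = 0) ∧
  (∀ e : Fin N, C.IsBackScrew N φ m v e →
    ∀ u : C.V, u ≠ v (m - 2) → u ≠ v (m - 3) → φ u e = 0)

end Config
/-- The path graph on the disjoint union of the components encoded by a list of lists:
two vertices are adjacent iff they lie in the same component in consecutive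
positions. -/
def ofListGraph (L : List (List ℤ)) :
    SimpleGraph ((i : Fin L.length) × Fin (L.get i).length) where
  Adj a b := a.1 = b.1 ∧ ((a.2 : ℕ) + 1 = (b.2 : ℕ) ∨ (b.2 : ℕ) + 1 = (a.2 : ℕ))
  symm := ⟨fun a b h => ⟨h.1.symm, h.2.symm⟩⟩
  loopless := by
    constructor
    intro a h
    rcases h with ⟨-, h | h⟩ <;> omega

instance ofListGraphDec (L : List (List ℤ)) : DecidableRel (ofListGraph L).Adj :=
  fun a b => decidable_of_iff
    (a.1 = b.1 ∧ ((a.2 : ℕ) + 1 = (b.2 : ℕ) ∨ (b.2 : ℕ) + 1 = (a.2 : ℕ))) Iff.rfl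

/-- The configuration (disjoint union of weighted paths) encoded by a list of
components, each component being the list of its weights read along the path. -/
def ofList (L : List (List ℤ)) : Config where
  V := (i : Fin L.length) × Fin (L.get i).length
  fin := inferInstance
  deq := inferInstance
  graph := ofListGraph L
  adjDec := ofListGraphDec L
  w := fun a => (L.get a.1).get a.2

/-- `A` occurs as an induced subgraph of `B`: an injective, weight-preserving map
that preserves and reflects adjacency. -/
def IsInducedSubgraph (A B : Config) : Prop :=
  ∃ f : A.V → B.V, Function.Injective f ∧
    (∀ v, B.w (f v) = A.w v) ∧
    (∀ u v, A.graph.Adj u v ↔ B.graph.Adj (f u) (f v))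

/-- `A` is (isomorphic to) the subgraph of `B` induced by the vertex set `S`. -/
def IsInducedOn (A B : Config) (S : Set B.V) : Prop :=
  ∃ f : A.V → B.V, Function.Injective f ∧
    (∀ v, B.w (f v) = A.w v) ∧
    (∀ u v, A.graph.Adj u v ↔ B.graph.Adj (f u) (f v)) ∧
    Set.range f = S

/-- Negative continued fraction `[a₁,…,aₙ]⁻ = a₁ - 1/[a₂,…,aₙ]⁻` (the empty list is
sent to `0`; with the junk value `1/0 = 0` this gives `[aₙ]⁻ = aₙ`). -/
def negCF : List ℤ → ℚ
  | [] => 0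
  | a :: l => (a : ℚ) - 1 / negCF l

/-- The (positive) sequences `a` and `b` are dual: for some coprime `p > q > 0`,
`[a]⁻ = p/q` and `[b]⁻ = p/(p-q)`. -/
def DualSeqs (a b : List ℤ) : Prop :=
  a ≠ [] ∧ b ≠ [] ∧ (∀ x ∈ a, 2 ≤ x) ∧ (∀ x ∈ b, 2 ≤ x) ∧
  ∃ p q : ℤ, 0 < q ∧ q < p ∧ Int.gcd p q = 1 ∧
    negCF a = (p : ℚ) / (q : ℚ) ∧ negCF b = (p : ℚ) / ((p : ℚ) - (q : ℚ))

/-- `P` encodes a canonical plumbing graph (weights `≤ -2`) and `D` encodes its dual: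
the components correspond to each other and each pair of weight sequences is dual. -/
def IsDualPair (P D : List (List ℤ)) : Prop :=
  ∃ h : P.length = D.length,
    ∀ i : Fin P.length,
      DualSeqs ((P.get i).map fun x => -x) (D.get (Fin.cast h i))

/-- The total number of vertices encoded by a list of components. -/
def totalLen (L : List (List ℤ)) : ℕ := (L.map List.length).sum

/-- The canonical plumbing graph encoded by `P`, with dual encoded by `D`, fails
Property `X_k`: its dual admits an embedding into `ℤ^(n-k)`, where
`n = |V(G)| + |V(Γ)|`. -/
def FailsX (k : ℕ) (P D : List (List ℤ)) : Prop :=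
  k ≤ totalLen P + totalLen D ∧
  ∃ φ : (ofList D).V → Fin (totalLen P + totalLen D - k) → ℤ,
    (ofList D).IsEmbedding (totalLen P + totalLen D - k) φ

/-- The seventeen forbidden configurations of Theorem B (iii), encoded as lists of
path components. -/
def forbidden17 : List (List (List ℤ)) :=
  [[[-5, -2]], [[-6, -2, -2]], [[-2], [-2]], [[-3], [-2, -2]], [[-3, -2, -2, -3]],
   [[-3, -5, -3, -2]], [[-2, -2, -3, -5]], [[-4, -3, -2]], [[-3, -4, -2]],
   [[-4, -4, -2, -2]], [[-3, -4, -3, -3, -2]], [[-3, -3], [-2]], [[-3, -2, -3], [-3]],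
   [[-4], [-4]], [[-4], [-3, -3]], [[-4], [-3, -2, -3]], [[-3, -3], [-3, -3]]]

namespace Config

/-- A shallow vertex of a canonical plumbing graph. -/
def IsShallow (C : Config) (v : C.V) : Prop :=
  C.w v = -2 ∨ C.w v = -4 ∨
  (C.w v = -3 ∧ ∃ u, C.graph.Adj v u ∧ C.w u = -2) ∨
  (C.w v = -3 ∧ ∃ u, C.graph.Adj v u ∧ C.w u = -3)

/-- A deep vertex of a canonical plumbing graph. -/
def IsDeep (C : Config) (v : C.V) : Prop :=
  (5 ≤ |C.w v| ∧ ∀ u, C.graph.Adj v u → ¬ C.IsShallow u) ∨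
  (C.w v = -3 ∧ ∀ u, ¬ C.graph.Adj v u)

end Config

/-- Add one to the head of a list. -/
def bumpHead : List ℤ → List ℤ
  | [] => []
  | x :: l => (x + 1) :: l

/-- Riemenschneider's dual of the sequence `g₁ + 2, …, gₙ + 2`. -/
def dualGaps : List ℕ → List ℤ
  | [] => [1]
  | d :: g => List.replicate d 2 ++ bumpHead (dualGaps g)

theorem dualGaps_ne_nil (g : List ℕ) : dualGaps g ≠ [] := by
  induction g with
  | nil => simp [dualGaps]
  | cons d g ih =>
    cases h : dualGaps g with
    | nil => exact absurd h ih
    | cons x l => simp [dualGaps, h, bumpHead]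

theorem dualGaps_succ_cons (d : ℕ) (g : List ℕ) :
    dualGaps ((d + 1) :: g) = 2 :: dualGaps (d :: g) := by
  simp [dualGaps, List.replicate_succ]

theorem two_le_of_mem_dualGaps_cons (d : ℕ) (g : List ℕ) :
    ∀ x ∈ dualGaps (d :: g), 2 ≤ x := by
  induction g generalizing d with
  | nil => intro x hx; simp [dualGaps, bumpHead] at hx; omega
  | cons e g ih =>
    intro x hx
    rw [dualGaps, List.mem_append] at hx
    rcases hx with hx | hx
    · rw [List.eq_of_mem_replicate hx]
    · have ih := ih e
      cases h : dualGaps (e :: g) with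
      | nil => simp [h, bumpHead] at hx
      | cons y l =>
        rw [h] at ih hx
        simp only [bumpHead, List.mem_cons] at hx ih
        rcases hx with rfl | hx
        · have := ih y (Or.inl rfl); omega
        · exact ih x (Or.inr hx)

theorem negCF_bumpHead {l : List ℤ} (hl : l ≠ []) : negCF (bumpHead l) = negCF l + 1 := by
  cases l with
  | nil => exact absurd rfl hl
  | cons x l => simp only [bumpHead, negCF]; push_cast; ring

theorem one_lt_negCF {l : List ℤ} (hl : l ≠ []) (h2 : ∀ x ∈ l, 2 ≤ x) : 1 < negCF l := by
  induction l with
  | nil => exact absurd rfl hl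
  | cons a l ih =>
    have ha : (2 : ℚ) ≤ a := by exact_mod_cast h2 a (by simp)
    rw [negCF]
    rcases eq_or_ne l [] with rfl | hl'
    · simp only [negCF, div_zero, sub_zero]; linarith
    · have h1 := ih hl' fun x hx => h2 x (by simp [hx])
      have : 1 / negCF l < 1 := by rw [div_lt_one (by linarith)]; exact h1
      linarith

theorem one_div_negCF_mem {l : List ℤ} (h2 : ∀ x ∈ l, 2 ≤ x) :
    0 ≤ 1 / negCF l ∧ 1 / negCF l < 1 := by
  rcases eq_or_ne l [] with rfl | hl
  · simp [negCF]
  · have h1 := one_lt_negCF hl h2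
    exact ⟨by positivity, by rw [div_lt_one (by linarith)]; exact h1⟩

/-- Uniqueness of negative continued fraction expansions. -/
theorem negCF_injective {l l' : List ℤ} (h2 : ∀ x ∈ l, 2 ≤ x) (h2' : ∀ x ∈ l', 2 ≤ x)
    (h : negCF l = negCF l') : l = l' := by
  induction l generalizing l' with
  | nil =>
    cases l' with
    | nil => rfl
    | cons b l' =>
      have := one_lt_negCF (by simp) h2'
      rw [← h, negCF] at this
      norm_num at this
  | cons a l ih =>
    cases l' with
    | nil =>
      have := one_lt_negCF (by simp) h2
      rw [h, negCF] at this
      norm_num at this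
    | cons b l' =>
      have hl : ∀ x ∈ l, 2 ≤ x := fun x hx => h2 x (by simp [hx])
      have hl' : ∀ x ∈ l', 2 ≤ x := fun x hx => h2' x (by simp [hx])
      obtain ⟨r0, r1⟩ := one_div_negCF_mem hl
      obtain ⟨s0, s1⟩ := one_div_negCF_mem hl'
      simp only [negCF] at h
      have hab : a = b := by
        have h1 : a < b + 1 := by
          have : (a : ℚ) < b + 1 := by linarith
          exact_mod_cast this
        have h3 : b < a + 1 := by
          have : (b : ℚ) < a + 1 := by linarith
          exact_mod_cast this
        omega
      subst hab
      have hinv : 1 / negCF l = 1 / negCF l' := by linarith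
      rw [one_div, one_div, inv_inj] at hinv
      rw [ih hl hl' hinv]

theorem one_div_negCF_dualGaps (g : List ℕ) :
    1 / negCF (dualGaps g) = 1 - 1 / negCF (g.map fun d : ℕ => (d : ℤ) + 2) := by
  induction g with
  | nil => simp [dualGaps, negCF]
  | cons d g ih =>
    have h2 (g : List ℕ) : ∀ x ∈ g.map (fun d : ℕ => (d : ℤ) + 2), 2 ≤ x := by
      intro x hx
      obtain ⟨d, -, rfl⟩ := List.mem_map.1 hx
      omega
    induction d with
    | zero =>
      obtain ⟨-, hr⟩ := one_div_negCF_mem (h2 g)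
      set r := 1 / negCF (g.map fun d : ℕ => (d : ℤ) + 2) with hrdef
      have hy : negCF (dualGaps g) = 1 / (1 - r) := by rw [← ih, one_div_one_div]
      have h1 : (1 : ℚ) - r ≠ 0 := by linarith
      have h3 : (2 : ℚ) - r ≠ 0 := by linarith
      rw [dualGaps, List.replicate_zero, List.nil_append, negCF_bumpHead (dualGaps_ne_nil g), hy,
        List.map_cons, negCF, ← hrdef]
      push_cast
      have h4 : 1 / (1 - r) + 1 = (2 - r) / (1 - r) := by field_simp; ring
      rw [h4, one_div_div]
      field_simp
      ring
    | succ d ihd =>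
      rw [dualGaps_succ_cons, negCF, ihd]
      have h1 := one_lt_negCF (by simp) (h2 (d :: g))
      have hx : negCF (((d + 1) :: g).map fun d : ℕ => (d : ℤ) + 2)
          = negCF ((d :: g).map fun d : ℕ => (d : ℤ) + 2) + 1 := by
        simp only [List.map_cons, negCF]; push_cast; ring
      rw [hx]
      set x := negCF ((d :: g).map fun d : ℕ => (d : ℤ) + 2)
      have hx0 : x ≠ 0 := by linarith
      have hx1 : x + 1 ≠ 0 := by linarith
      have h4 : (2 : ℤ) - (1 - 1 / x) = (x + 1) / x := by field_simp; push_cast; ring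
      rw [h4, one_div_div]
      field_simp
      ring

/-- The sequence dual to `a` is the one produced by Riemenschneider's recursion. -/
theorem DualSeqs.eq_dualGaps {a b : List ℤ} (h : DualSeqs a b) :
    b = dualGaps (a.map fun x => (x - 2).toNat) := by
  obtain ⟨ha, hb, ha2, hb2, p, q, hq, hqp, -, hpa, hpb⟩ := h
  set g := a.map fun x => (x - 2).toNat with hg
  have hga : g.map (fun d : ℕ => (d : ℤ) + 2) = a := by
    rw [hg, List.map_map]
    conv_rhs => rw [← List.map_id a]
    refine List.map_congr_left fun x hx => ?_
    have := ha2 x hx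
    simp only [Function.comp_apply, id]
    omega
  have hinv := one_div_negCF_dualGaps g
  rw [hga, hpa] at hinv
  have hp : (0 : ℚ) < p := by exact_mod_cast hq.trans hqp
  have hpq : (0 : ℚ) < (p : ℚ) - q := by
    have : (q : ℚ) < p := by exact_mod_cast hqp
    linarith
  have hd2 : ∀ x ∈ dualGaps g, 2 ≤ x := by
    cases a with
    | nil => exact absurd rfl ha
    | cons x a => exact two_le_of_mem_dualGaps_cons _ _
  refine negCF_injective hb2 hd2 ?_
  rw [hpb, ← one_div_one_div (negCF (dualGaps g)), hinv, one_div_div]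
  have : (1 : ℚ) - q / p = (p - q) / p := by field_simp
  rw [this, one_div_div]

/-- The rows of the Riemenschneider diagram, viewed as marks on the vertices of the dual path: the
`k`-th mark sits at `pos k`, and `F j` is the number of marks strictly to the left of `j`. -/
theorem exists_marks_dualGaps (g : List ℕ) :
    ∃ pos F : ℕ → ℕ, pos 0 = 0 ∧ (∀ k, (h : k < g.length) → pos (k + 1) = pos k + g[k]) ∧
      (∀ k ≤ g.length, ∀ j, pos k < j ↔ k < F j) ∧ (∀ j, F j ≤ g.length + 1) ∧
      pos g.length + 1 = (dualGaps g).length ∧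
      ∀ j, (h : j < (dualGaps g).length) →
        (dualGaps g)[j] = F (j + 1) - F j + (if 0 < j then 1 else 0) +
          (if j + 1 < (dualGaps g).length then 1 else 0) := by
  induction g with
  | nil =>
    refine ⟨fun _ => 0, fun j => min j 1, rfl, by simp, ?_, by simp, by simp [dualGaps], ?_⟩
    · intro k hk j
      simp only [List.length_nil, Nat.le_zero] at hk
      subst hk
      simp
    · intro j hj
      simp only [dualGaps, List.length_singleton, Nat.lt_one_iff] at hj
      subst hj
      simp [dualGaps]
  | cons d g ih =>
    induction d with
    | zero =>
      obtain ⟨pos, F, h0, h1, h2, h3, h4, h5⟩ := ih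
      obtain ⟨x, l, hxl⟩ := List.exists_cons_of_ne_nil (dualGaps_ne_nil g)
      have hd : dualGaps (0 :: g) = (x + 1) :: l := by simp [dualGaps, hxl, bumpHead]
      have hF0 : F 0 = 0 := by have := h2 0 (by omega) 0; omega
      simp only [hxl, List.length_cons] at h4 h5
      refine ⟨fun k => pos (k - 1), fun j => if j = 0 then 0 else F j + 1, h0, ?_, ?_, ?_, ?_, ?_⟩
      · intro k hk
        cases k with
        | zero => simp
        | succ k => simpa using h1 k (by simpa using hk)
      · intro k hk j
        cases k with
        | zero => simp only [Nat.zero_sub, h0]; split <;> omega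
        | succ k =>
          have := h2 k (by simpa using hk) j
          simp only [Nat.add_sub_cancel]
          split <;> omega
      · intro j
        have := h3 j
        simp only [List.length_cons]; split <;> omega
      · simpa [hd] using h4
      · intro j hj
        simp only [hd, List.length_cons] at hj ⊢
        have := h5 j hj
        cases j with
        | zero => simp [hF0] at this ⊢; omega
        | succ j => simp at this ⊢; omega
    | succ d ihd =>
      obtain ⟨pos, F, h0, h1, h2, h3, h4, h5⟩ := ihd
      have hd := dualGaps_succ_cons d g
      have hF0 : F 0 = 0 := by have := h2 0 (by omega) 0; omega
      have hlen := List.length_pos_iff.2 (dualGaps_ne_nil (d :: g))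
      refine ⟨fun k => if k = 0 then 0 else pos k + 1,
        fun j => if j = 0 then 0 else if j = 1 then 1 else F (j - 1), rfl, ?_, ?_, ?_, ?_, ?_⟩
      · intro k hk
        have := h1 k hk
        cases k with
        | zero => simp [h0] at this ⊢; omega
        | succ k => simp at this ⊢; omega
      · intro k hk j
        match j with
        | 0 => simp
        | 1 => simp
        | j + 2 =>
          have h := h2 k hk (j + 1)
          have h' := h2 0 (by omega) (j + 1)
          simp
          split <;> omega
      · intro j
        have := h3 (j - 1)
        simp only [List.length_cons] at this ⊢
        split
        · omega
        · split <;> omega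
      · simpa [hd] using h4
      · intro j hj
        simp only [hd, List.length_cons] at hj ⊢
        match j with
        | 0 => simp [hlen]
        | 1 =>
          have := h5 0 hlen
          simp [hF0] at this ⊢
          omega
        | j + 2 =>
          have := h5 (j + 1) (by omega)
          simp at this ⊢
          omega

/-- A family of paths carrying marks.  The path `c` has `n c + 1` marks, the `k`-th one sits at
the vertex `pos c k`, consecutive marks are `gap c k` apart, and `F c j` marks lie strictly to the
left of the vertex `j`. -/
structure MarkSystem (ι : Type) where
  n : ι → ℕ
  gap : ι → ℕ → ℕ
  pos : ι → ℕ → ℕ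
  F : ι → ℕ → ℕ
  pos_succ : ∀ c k, k < n c → pos c (k + 1) = pos c k + gap c k
  pos_lt_iff : ∀ c k, k ≤ n c → ∀ j, pos c k < j ↔ k < F c j
  F_le : ∀ c j, F c j ≤ n c + 1

namespace MarkSystem

variable {ι : Type} (S : MarkSystem ι)

/-- The number of marks at the vertex `j` of the path `c`. -/
def W (c : ι) (j : ℕ) : ℤ := S.F c (j + 1) - S.F c j

/-- The vertex `y + 1` of the path `c` lies between two marked vertices. -/
def BadSucc (c : ι) (y : ℕ) : Prop := 0 < S.W c y ∧ 0 < S.W c (y + 2)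

/-- The gaps of the path `c` read `l` from the `k`-th one on. -/
def Seg (c : ι) : List ℕ → ℕ → Prop
  | [], _ => True
  | d :: l, k => (k < S.n c ∧ S.gap c k = d) ∧ Seg c l (k + 1)

/-- The numbers of marks on the path `c` read `p` from the vertex `j` on. -/
def Reads (c : ι) : List ℤ → ℕ → Prop
  | [], _ => True
  | x :: p, j => S.W c j = x ∧ Reads c p (j + 1)

/-- None of the forbidden configurations occurs, expressed through gaps. -/
structure Admissible : Prop where
  path : ∀ l : List ℕ, [l.map fun d : ℕ => -2 - (d : ℤ)] ∈ forbidden17 → ∀ c k,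
    ¬ S.Seg c l k ∧ ¬ S.Seg c l.reverse k
  pair : ∀ l l' : List ℕ,
    [l.map fun d : ℕ => -2 - (d : ℤ), l'.map fun d : ℕ => -2 - (d : ℤ)] ∈ forbidden17 →
    ∀ c c' k k', S.Seg c l k → S.Seg c' l' k' →
      c = c' ∧ k' ≤ k + l.length ∧ k ≤ k' + l'.length

/-- The gaps forced by a sequence of numbers of marks; `d` counts the steps made since the last
mark. -/
def gapsOf (d : ℕ) : List ℕ → List ℕ
  | [] => []
  | 0 :: t => gapsOf (d + 1) t
  | (x + 1) :: t => d :: gapsOf 0 (x :: t)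
termination_by t => t.length + t.sum

variable {S}

theorem F_mono (c : ι) {i j : ℕ} (h : i ≤ j) : S.F c i ≤ S.F c j := by
  by_contra! hlt
  have hk : S.F c j ≤ S.n c := by have := S.F_le c i; omega
  have h1 := (S.pos_lt_iff c _ hk i).2 hlt
  have h2 := S.pos_lt_iff c _ hk j
  omega

theorem W_nonneg (c : ι) (j : ℕ) : 0 ≤ S.W c j := by
  have := F_mono (S := S) c (Nat.le_succ j)
  simp only [W, Nat.succ_eq_add_one] at *
  omega

theorem pos_eq {c : ι} {j k : ℕ} (h : S.F c j ≤ k) (h' : k < S.F c (j + 1)) :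
    k ≤ S.n c ∧ S.pos c k = j := by
  have hk : k ≤ S.n c := by have := S.F_le c (j + 1); omega
  have h1 := S.pos_lt_iff c k hk j
  have h2 := S.pos_lt_iff c k hk (j + 1)
  exact ⟨hk, by omega⟩

theorem gap_eq {c : ι} {j k : ℕ} (d : ℕ) (h1 : S.F c j ≤ k) (h2 : k < S.F c (j + 1))
    (h3 : S.F c (j + d) ≤ k + 1) (h4 : k + 1 < S.F c (j + d + 1)) :
    k < S.n c ∧ S.gap c k = d := by
  obtain ⟨-, hp⟩ := pos_eq h1 h2
  obtain ⟨hk, hp'⟩ := pos_eq h3 h4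
  have := S.pos_succ c k hk
  exact ⟨hk, by omega⟩

theorem seg_gapsOf {c : ι} : ∀ {t : List ℕ} {j d k : ℕ}, S.F c j ≤ k → k < S.F c (j + 1) →
    S.F c (j + d) ≤ k + 1 → (∀ i < t.length, S.F c (j + d + i + 1) =
      (k + 1) + (t.take (i + 1)).sum) → S.Seg c (gapsOf d t) k
  | [], _, _, _, _, _, _, _ => by simp [gapsOf, Seg]
  | 0 :: t, j, d, k, h1, h2, h3, h4 => by
    rw [gapsOf]
    have h0 := h4 0 (by simp)
    refine seg_gapsOf (d := d + 1) h1 h2 ?_ fun i hi => ?_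
    · simp at h0; rw [← add_assoc]; omega
    · have := h4 (i + 1) (by simpa using hi)
      simp at this
      rw [← this]
      congr 1
      omega
  | (x + 1) :: t, j, d, k, h1, h2, h3, h4 => by
    rw [gapsOf]
    have h0 := h4 0 (by simp)
    simp at h0
    refine ⟨gap_eq d h1 h2 h3 (by omega), ?_⟩
    refine seg_gapsOf (j := j + d) (d := 0) (h3.trans (by omega)) (by omega)
      (h3.trans (by omega)) fun i hi => ?_
    have := h4 i (by simpa using hi)
    simp at this ⊢
    omega
termination_by t => t.length + t.sum

theorem seg_of_reads {c : ι} {x : ℕ} {t : List ℕ} {j : ℕ}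
    (h : S.Reads c (((x + 1) :: t).map fun n : ℕ => (n : ℤ)) j) :
    S.Seg c (gapsOf 0 (x :: t)) (S.F c j) := by
  have key : ∀ (t : List ℕ) (j : ℕ), S.Reads c (t.map fun n : ℕ => (n : ℤ)) j →
      ∀ i, i < t.length → S.F c (j + i + 1) = S.F c j + (t.take (i + 1)).sum := by
    intro t
    induction t with
    | nil => simp
    | cons y t ih =>
      intro j hj i hi
      obtain ⟨h0, h1⟩ := hj
      replace h0 : (S.F c (j + 1) : ℤ) - S.F c j = y := h0
      cases i with
      | zero => simp; omega
      | succ i =>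
        have := ih (j + 1) h1 i (by simpa using hi)
        simp
        rw [show j + (i + 1) + 1 = j + 1 + i + 1 by omega, this]
        omega
  have h0 := key _ _ h 0 (by simp)
  simp at h0
  refine seg_gapsOf (j := j) le_rfl (by omega) (by simp) fun i hi => ?_
  have := key _ _ h i (by simpa using hi)
  simp at this ⊢
  omega

theorem exists_seg_of_append {c : ι} (l₁ : List ℕ) {l l₂ : List ℕ} {k : ℕ}
    (h : S.Seg c (l₁ ++ l ++ l₂) k) : ∃ k', S.Seg c l k' := by
  induction l₁ generalizing k with
  | cons d l₁ ih => exact ih h.2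
  | nil =>
    refine ⟨k, ?_⟩
    rw [List.nil_append] at h
    induction l generalizing k with
    | nil => trivial
    | cons d l ih => exact ⟨h.1, ih h.2⟩

theorem Admissible.not_reads (hS : S.Admissible) {x y : ℕ} {t s l₂ : List ℕ} (l : List ℕ)
    (hl : [l.map fun d : ℕ => -2 - (d : ℤ)] ∈ forbidden17)
    (hrev : (y + 1) :: s = ((x + 1) :: t).reverse)
    (hup : gapsOf 0 (x :: t) = l ++ l₂) (hdown : gapsOf 0 (y :: s) = l₂.reverse ++ l.reverse)
    (c : ι) (j : ℕ) : ¬ S.Reads c (((x + 1) :: t).map fun n : ℕ => (n : ℤ)) j ∧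
      ¬ S.Reads c (((x + 1) :: t).map fun n : ℕ => (n : ℤ)).reverse j := by
  constructor <;> intro h
  · obtain ⟨k, hk⟩ := exists_seg_of_append [] (by simpa [hup] using seg_of_reads h)
    exact (hS.path l hl c k).1 hk
  · rw [← List.map_reverse, ← hrev] at h
    obtain ⟨k, hk⟩ := exists_seg_of_append (l₂ := []) l₂.reverse
      (by simpa [hdown] using seg_of_reads h)
    exact (hS.path l hl c k).2 hk

/-- Working Condition VI. -/
theorem Admissible.not_reads_forbiddenPatterns (hS : S.Admissible) {p : List ℤ}
    (hp : p ∈ forbiddenPatterns) (c : ι) (j : ℕ) :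
    ¬ S.Reads c p j ∧ ¬ S.Reads c p.reverse j := by
  have key {x : ℕ} (y : ℕ) {t s : List ℕ} (l l₂ : List ℕ) :=
    hS.not_reads (x := x) (y := y) (t := t) (s := s) (l₂ := l₂) l
  simp only [forbiddenPatterns, List.mem_cons, List.not_mem_nil, or_false] at hp
  rcases hp with rfl | rfl | rfl | rfl | rfl | rfl | rfl | rfl | rfl
  · exact key (x := 0) 1 (t := [0, 0, 2]) (s := [0, 0, 1]) [3, 0] []
      (by decide) (by decide) (by simp [gapsOf]) (by simp [gapsOf]) c j
  · exact key (x := 0) 2 (t := [0, 0, 3]) (s := [0, 0, 1]) [3, 0] [0]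
      (by decide) (by decide) (by simp [gapsOf]) (by simp [gapsOf]) c j
  · exact key (x := 0) 2 (t := [0, 0, 0, 3]) (s := [0, 0, 0, 1]) [4, 0, 0] []
      (by decide) (by decide) (by simp [gapsOf]) (by simp [gapsOf]) c j
  · exact key (x := 0) 1 (t := [1, 0, 0, 1, 2]) (s := [1, 0, 0, 1, 1]) [1, 3, 1, 0] []
      (by decide) (by decide) (by simp [gapsOf]) (by simp [gapsOf]) c j
  · exact key (x := 2) 0 (t := [1, 0, 0, 1]) (s := [0, 0, 1, 3]) [0, 0, 1, 3] []
      (by decide) (by decide) (by simp [gapsOf]) (by simp [gapsOf]) c j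
  · exact key (x := 0) 1 (t := [0, 1, 2]) (s := [1, 0, 1]) [2, 1, 0] []
      (by decide) (by decide) (by simp [gapsOf]) (by simp [gapsOf]) c j
  · exact key (x := 0) 2 (t := [0, 1, 3]) (s := [1, 0, 1]) [2, 1, 0] [0]
      (by decide) (by decide) (by simp [gapsOf]) (by simp [gapsOf]) c j
  · exact key (x := 0) 1 (t := [1, 0, 2]) (s := [0, 1, 1]) [1, 2, 0] []
      (by decide) (by decide) (by simp [gapsOf]) (by simp [gapsOf]) c j
  · exact key (x := 0) 1 (t := [1, 0, 1, 1, 2]) (s := [1, 1, 0, 1, 1]) [1, 2, 1, 1, 0] []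
      (by decide) (by decide) (by simp [gapsOf]) (by simp [gapsOf]) c j

theorem seg_singleton {c : ι} {d k : ℕ} : S.Seg c [d] k ↔ k < S.n c ∧ S.gap c k = d := by
  simp [Seg]

theorem Admissible.pair_gaps (hS : S.Admissible) (l l' : List ℕ)
    (hl : [l.map fun d : ℕ => -2 - (d : ℤ), l'.map fun d : ℕ => -2 - (d : ℤ)] ∈ forbidden17)
    {c : ι} {k k' : ℕ} (h : S.Seg c l k) (h' : S.Seg c l' k') :
    k' ≤ k + l.length ∧ k ≤ k' + l'.length :=
  (hS.pair l l' hl c c k k' h h').2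

theorem seg_zero_of_two_le_W {c : ι} {j : ℕ} (h : 2 ≤ S.W c j) : S.Seg c [0] (S.F c j) := by
  rw [W] at h
  exact seg_singleton.2 (gap_eq 0 le_rfl (by omega) (by simp) (by simp; omega))

theorem seg_zero_pred_of_two_le_W {c : ι} {j : ℕ} (h : 2 ≤ S.W c j) :
    ∃ i, i + 2 = S.F c (j + 1) ∧ S.Seg c [0] i := by
  rw [W] at h
  exact ⟨S.F c (j + 1) - 2, by omega, seg_singleton.2
    (gap_eq (j := j) 0 (by omega) (by omega) (by simp; omega) (by simp; omega))⟩

theorem seg_zero_zero_of_three_le_W {c : ι} {j : ℕ} (h : 3 ≤ S.W c j) :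
    S.Seg c [0, 0] (S.F c j) := by
  refine ⟨seg_singleton.1 (seg_zero_of_two_le_W (by omega)), ?_⟩
  rw [W] at h
  exact seg_singleton.2 (gap_eq (j := j) 0 (by omega) (by omega) (by simp; omega) (by simp; omega))

theorem seg_zero_zero_pred_of_three_le_W {c : ι} {j : ℕ} (h : 3 ≤ S.W c j) :
    ∃ i, i + 3 = S.F c (j + 1) ∧ S.Seg c [0, 0] i := by
  obtain ⟨i, hi, hs⟩ := seg_zero_pred_of_two_le_W (S := S) (c := c) (j := j) (by omega)
  rw [W] at h
  refine ⟨S.F c (j + 1) - 3, by omega, gap_eq (j := j) 0 (by omega) (by omega) (by simp; omega)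
    (by simp; omega), ?_⟩
  rwa [show S.F c (j + 1) - 3 + 1 = i by omega]

/-- Working Condition II, first half. -/
theorem Admissible.W_le_three (hS : S.Admissible) (c : ι) (j : ℕ) : S.W c j ≤ 3 := by
  by_contra! h
  obtain ⟨i, hi, hs⟩ := seg_zero_pred_of_two_le_W (S := S) (c := c) (j := j) (by omega)
  have := hS.pair_gaps [0] [0] (by decide)
    (seg_zero_of_two_le_W (j := j) (by omega)) hs
  rw [W] at h
  simp at this
  omega

/-- Working Condition II, second half. -/
theorem Admissible.eq_of_one_lt_W (hS : S.Admissible) {c c' : ι} {j j' : ℕ} (h : 1 < S.W c j)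
    (h' : 1 < S.W c' j') : c = c' ∧ j = j' := by
  obtain ⟨rfl, h1, h2⟩ := hS.pair [0] [0] (by decide) c c' _ _ (seg_zero_of_two_le_W h)
    (seg_zero_of_two_le_W h')
  refine ⟨rfl, ?_⟩
  simp only [List.length_singleton] at h1 h2
  rw [W] at h h'
  by_contra hne
  rcases Nat.lt_or_gt_of_ne hne with hlt | hlt <;>
  · have := F_mono (S := S) c hlt
    simp only [Nat.succ_eq_add_one] at this
    omega

theorem Admissible.bad_cases (hS : S.Admissible) {c : ι} {y : ℕ} (h : S.BadSucc c y) :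
    ∃ k, S.F c (y + 1) = k + 1 ∧ S.pos c k = y ∧
      ((S.W c (y + 1) = 0 ∧ S.Seg c [2] k) ∨ (S.W c (y + 1) = 1 ∧ S.Seg c [1, 1] k) ∨
        (S.W c (y + 1) = 2 ∧ S.Seg c [1, 0, 1] k)) := by
  have h3 := hS.W_le_three c (y + 1)
  have h0 := W_nonneg (S := S) c (y + 1)
  obtain ⟨h1, h2⟩ := h
  simp only [W] at h0 h1 h2 h3 ⊢
  change 0 < (S.F c (y + 1 + 1 + 1) : ℤ) - S.F c (y + 1 + 1) at h2
  obtain ⟨k, hk⟩ : ∃ k, S.F c (y + 1) = k + 1 := ⟨S.F c (y + 1) - 1, by omega⟩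
  refine ⟨k, hk, (pos_eq (by omega) (by omega)).2, ?_⟩
  obtain h | h | h | h : S.F c (y + 1 + 1) = k + 1 ∨ S.F c (y + 1 + 1) = k + 2 ∨
    S.F c (y + 1 + 1) = k + 3 ∨ S.F c (y + 1 + 1) = k + 4 := by omega
  · exact Or.inl ⟨by omega, seg_singleton.2
      (gap_eq (j := y) 2 (by omega) (by omega) (show S.F c (y + 1 + 1) ≤ k + 1 by omega)
        (show k + 1 < S.F c (y + 1 + 1 + 1) by omega))⟩
  · exact Or.inr (Or.inl ⟨by omega,
      gap_eq (j := y) 1 (by omega) (by omega) (by omega) (by omega), seg_singleton.2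
      (gap_eq (j := y + 1) 1 (by omega) (by omega) (by omega) (by omega))⟩)
  · exact Or.inr (Or.inr ⟨by omega,
      gap_eq (j := y) 1 (by omega) (by omega) (by omega) (by omega),
      gap_eq (j := y + 1) 0 (by omega) (by omega) (by simp; omega) (by simp; omega),
      seg_singleton.2 (gap_eq (j := y + 1) 1 (by omega) (by omega) (by omega) (by omega))⟩)
  · exact absurd ⟨gap_eq (j := y) 1 (by omega) (by omega) (by omega) (by omega),
      gap_eq (j := y + 1) 0 (by omega) (by omega) (by simp; omega) (by simp; omega),
      gap_eq (j := y + 1) 0 (by omega) (by omega) (by simp; omega) (by simp; omega),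
      seg_singleton.2 (gap_eq (j := y + 1) 1 (by omega) (by omega) (by omega) (by omega))⟩
      (hS.path [1, 0, 0, 1] (by decide) c k).1

/-- Working Condition III. -/
theorem Admissible.adj_of_one_lt_W_of_bad (hS : S.Admissible) {c c' : ι} {j y : ℕ}
    (h : 1 < S.W c j) (hb : S.BadSucc c' y) (h1 : S.W c' (y + 1) = 1) :
    c = c' ∧ (j = y ∨ j = y + 2) := by
  obtain ⟨k, hk, hpos, ⟨h0, -⟩ | ⟨-, hs⟩ | ⟨h2, -⟩⟩ := hS.bad_cases hb
  · omega
  · have hz := seg_zero_of_two_le_W h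
    obtain ⟨rfl, hle, hle'⟩ := hS.pair [1, 1] [0] (by decide) c' c _ _ hs hz
    refine ⟨rfl, ?_⟩
    simp only [List.length_cons, List.length_nil] at hle hle'
    obtain ⟨hb1, hb2⟩ := hb
    simp only [W] at h h1 hb1 hb2
    by_contra! hne
    have hj : j ≠ y + 1 := by rintro rfl; omega
    rcases Nat.lt_or_ge j y with hlt | hge
    · have := F_mono (S := S) c' (i := j + 1) (j := y) (by omega)
      omega
    · have := F_mono (S := S) c' (i := y + 3) (j := j) (by omega)
      simp only [Nat.add_assoc] at *
      norm_num at *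
      omega
  · omega

/-- Working Condition IV. -/
theorem Admissible.not_adj_ones (hS : S.Admissible) {c c' : ι} {j u : ℕ}
    (h : S.W c j = 3) (h1 : S.W c' u = 1) (h2 : S.W c' (u + 1) = 1) : False := by
  have hs := seg_zero_zero_of_three_le_W (S := S) (c := c) (j := j) (by omega)
  have hu : S.Seg c' [1] (S.F c' u) := by
    simp only [W] at h1 h2
    exact seg_singleton.2 (gap_eq (j := u) 1 (by omega) (by omega) (by omega) (by omega))
  obtain ⟨rfl, hle, hle'⟩ := hS.pair [1] [0, 0] (by decide) c' c _ _ hu hs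
  simp only [List.length_cons, List.length_nil] at hle hle'
  simp only [W] at h h1 h2
  have hj : j ≠ u := by rintro rfl; omega
  have hj' : j ≠ u + 1 := by rintro rfl; omega
  rcases Nat.lt_or_ge j u with hlt | hge
  · have := F_mono (S := S) c' (i := j + 1) (j := u) (by omega)
    omega
  · have := F_mono (S := S) c' (i := u + 2) (j := j) (by omega)
    simp only [Nat.add_assoc] at *
    norm_num at *
    omega

/-- Working Condition V. -/
theorem Admissible.adj_of_bad_two (hS : S.Admissible) {c c' : ι} {u y : ℕ}
    (h1 : S.W c u = 1) (h2 : S.W c (u + 1) = 1) (hb : S.BadSucc c' y)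
    (h : S.W c' (y + 1) = 2) : c = c' ∧ (u + 1 = y ∨ u = y + 2) := by
  obtain ⟨k, hk, hpos, ⟨h0, -⟩ | ⟨h1', -⟩ | ⟨-, hs⟩⟩ := hS.bad_cases hb
  · omega
  · omega
  · have hu : S.Seg c [1] (S.F c u) := by
      simp only [W] at h1 h2
      exact seg_singleton.2 (gap_eq (j := u) 1 (by omega) (by omega) (by omega) (by omega))
    obtain ⟨rfl, hle, hle'⟩ := hS.pair [1, 0, 1] [1] (by decide) c' c _ _ hs hu
    refine ⟨rfl, ?_⟩
    simp only [List.length_cons, List.length_nil] at hle hle'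
    obtain ⟨hb1, hb2⟩ := hb
    simp only [W] at h h1 h2 hb1 hb2
    by_contra! hne
    have hj : u ≠ y + 1 := by rintro rfl; omega
    have hj' : u ≠ y := by rintro rfl; omega
    rcases Nat.lt_or_ge u y with hlt | hge
    · have := F_mono (S := S) c' (i := u + 2) (j := y) (by omega)
      simp only [Nat.add_assoc] at *
      norm_num at *
      omega
    · have := F_mono (S := S) c' (i := y + 3) (j := u) (by omega)
      simp only [Nat.add_assoc] at *
      norm_num at *
      omega

theorem Admissible.eq_of_bad (hS : S.Admissible) {c c' : ι} {y y' : ℕ} (h : S.BadSucc c y)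
    (h' : S.BadSucc c' y') : c = c' := by
  obtain ⟨k, -, -, ⟨-, hs⟩ | ⟨-, hs⟩ | ⟨-, hs⟩⟩ := hS.bad_cases h <;>
  obtain ⟨k', -, -, ⟨-, hs'⟩ | ⟨-, hs'⟩ | ⟨-, hs'⟩⟩ := hS.bad_cases h'
  · exact (hS.pair [2] [2] (by decide) _ _ _ _ hs hs').1
  · exact (hS.pair [2] [1, 1] (by decide) _ _ _ _ hs hs').1
  · exact (hS.pair [2] [1, 0, 1] (by decide) _ _ _ _ hs hs').1
  · exact (hS.pair [2] [1, 1] (by decide) _ _ _ _ hs' hs).1.symm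
  · exact (hS.pair [1, 1] [1, 1] (by decide) _ _ _ _ hs hs').1
  · exact (hS.pair [1, 0, 1] [1] (by decide) _ _ _ _ hs' (seg_singleton.2 hs.1)).1.symm
  · exact (hS.pair [2] [1, 0, 1] (by decide) _ _ _ _ hs' hs).1.symm
  · exact (hS.pair [1, 0, 1] [1] (by decide) _ _ _ _ hs (seg_singleton.2 hs'.1)).1
  · exact (hS.pair [1, 0, 1] [1] (by decide) _ _ _ _ hs (seg_singleton.2 hs'.1)).1

/-- The numbers of marks read `ws` on the path `c` from `y` on, where `ws` is one of the sequences
of Working Condition VII up to reversal. -/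
def ReadsBadPattern (S : MarkSystem ι) (c : ι) (y : ℕ) (ws : List ℤ) : Prop :=
  S.Reads c ws y ∧ ∃ p, (p ∈ badPatterns ∨ p.reverse ∈ badPatterns) ∧ p.map Prod.fst = ws

theorem F_succ (c : ι) (j : ℕ) : (S.F c (j + 1) : ℤ) = S.F c j + S.W c j := by
  simp [W]

theorem Admissible.exists_readsBadPattern_of_bad (hS : S.Admissible) {c : ι} {y : ℕ}
    (h : S.BadSucc c y) : ∃ ws, S.ReadsBadPattern c y ws ∧ ws.length = 3 := by
  obtain ⟨k, hk, -, hcases⟩ := hS.bad_cases h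
  obtain ⟨h1, h2⟩ := h
  have e0 := F_succ (S := S) c y
  have e1 := F_succ (S := S) c (y + 1)
  have e2 := F_succ (S := S) c (y + 2)
  have a3 := hS.W_le_three c y
  have b3 := hS.W_le_three c (y + 2)
  have hab : ¬ (1 < S.W c y ∧ 1 < S.W c (y + 2)) := fun ⟨ha, hb⟩ => by
    have := (hS.eq_of_one_lt_W ha hb).2
    omega
  have hlen (a x b : ℤ) (ha : S.W c y = a) (hx : S.W c (y + 1) = x) (hb : S.W c (y + 2) = b)
      (hp : ∃ p, (p ∈ badPatterns ∨ p.reverse ∈ badPatterns) ∧ p.map Prod.fst = [a, x, b]) :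
      ∃ ws, S.ReadsBadPattern c y ws ∧ ws.length = 3 :=
    ⟨[a, x, b], ⟨⟨ha, hx, hb, trivial⟩, hp⟩, rfl⟩
  simp only [Nat.add_assoc, Nat.reduceAdd] at *
  rcases hcases with ⟨hx, hs⟩ | ⟨hx, hs⟩ | ⟨hx, hs⟩
  · obtain ha | ha | ha : S.W c y = 1 ∨ S.W c y = 2 ∨ S.W c y = 3 := by omega
    · obtain hb | hb | hb : S.W c (y + 2) = 1 ∨ S.W c (y + 2) = 2 ∨ S.W c (y + 2) = 3 := by omega
      · exact hlen 1 0 1 ha hx hb ⟨[(1, false), (0, true), (1, false)], by decide, rfl⟩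
      · exact hlen 1 0 2 ha hx hb ⟨[(1, false), (0, true), (2, false)], by decide, rfl⟩
      · exact hlen 1 0 3 ha hx hb ⟨[(1, false), (0, true), (3, false)], by decide, rfl⟩
    · exact hlen 2 0 1 ha hx (by omega) ⟨[(2, false), (0, true), (1, false)], by decide, rfl⟩
    · exact hlen 3 0 1 ha hx (by omega) ⟨[(3, false), (0, true), (1, false)], by decide, rfl⟩
  · have ha3 : S.W c y < 3 := by
      by_contra! ha
      obtain ⟨i, hi, hz⟩ := seg_zero_zero_pred_of_three_le_W ha
      have := hS.pair_gaps [1] [0, 0] (by decide) (seg_singleton.2 hs.2.1) hz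
      simp only [List.length_cons, List.length_nil] at this
      omega
    have hb3 : S.W c (y + 2) < 3 := by
      by_contra! hb
      have := hS.pair_gaps [1] [0, 0] (by decide) (seg_singleton.2 hs.1)
        (seg_zero_zero_of_three_le_W hb)
      simp only [List.length_cons, List.length_nil] at this
      omega
    obtain ha | ha : S.W c y = 1 ∨ S.W c y = 2 := by omega
    · obtain hb | hb : S.W c (y + 2) = 1 ∨ S.W c (y + 2) = 2 := by omega
      · exact hlen 1 1 1 ha hx hb ⟨[(1, false), (1, true), (1, false)], by decide, rfl⟩
      · exact hlen 1 1 2 ha hx hb ⟨[(1, false), (1, true), (2, false)], by decide, rfl⟩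
    · exact hlen 2 1 1 ha hx (by omega) ⟨[(2, false), (1, true), (1, false)], by decide, rfl⟩
  · have hax (w : ℕ) (hw : w ≠ y + 1) : ¬ 1 < S.W c w := fun h =>
      hw (hS.eq_of_one_lt_W h (by omega : 1 < S.W c (y + 1))).2
    have := hax y (by omega)
    have := hax (y + 2) (by omega)
    exact hlen 1 2 1 (by omega) hx (by omega) ⟨[(1, false), (2, true), (1, false)], by decide, rfl⟩

theorem Admissible.exists_readsBadPattern_of_bad_bad (hS : S.Admissible) {c : ι} {y y' : ℕ}
    (h : S.BadSucc c y) (h' : S.BadSucc c y') (hlt : y < y') :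
    ∃ ws, S.ReadsBadPattern c y ws ∧ y + ws.length = y' + 3 := by
  obtain ⟨k, hk, hpos, hcases⟩ := hS.bad_cases h
  obtain ⟨k', hk', hpos', hcases'⟩ := hS.bad_cases h'
  obtain ⟨h1, h2⟩ := h
  obtain ⟨h1', h2'⟩ := h'
  have hkk : k < k' := by
    have := F_mono (S := S) c (i := y + 1) (j := y') hlt
    rw [W] at h1'
    omega
  have e0 := F_succ (S := S) c y
  have e1 := F_succ (S := S) c (y + 1)
  have e2 := F_succ (S := S) c (y + 2)
  have e3 := F_succ (S := S) c (y + 3)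
  have e4 := F_succ (S := S) c (y + 4)
  have a3 := hS.W_le_three c y
  have b3 := hS.W_le_three c (y' + 2)
  have hab : ¬ (1 < S.W c y ∧ 1 < S.W c (y' + 2)) := fun ⟨ha, hb⟩ => by
    have := (hS.eq_of_one_lt_W ha hb).2
    omega
  have left_one {l : List ℕ} (hl : [l.map fun d : ℕ => -2 - (d : ℤ), [-2]] ∈ forbidden17)
      {i : ℕ} (hs : S.Seg c l i) (hi : k < i) : S.W c y = 1 := by
    by_contra ha
    obtain ⟨j, hj, hz⟩ := seg_zero_pred_of_two_le_W (S := S) (c := c) (j := y) (by omega)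
    have := hS.pair_gaps l [0] hl hs hz
    simp only [List.length_singleton] at this
    omega
  have right_one {l : List ℕ} (hl : [l.map fun d : ℕ => -2 - (d : ℤ), [-2]] ∈ forbidden17)
      {i : ℕ} (hs : S.Seg c l i) (hi : i + l.length < S.F c (y' + 2)) : S.W c (y' + 2) = 1 := by
    by_contra hb
    have := hS.pair_gaps l [0] hl hs
      (seg_zero_of_two_le_W (S := S) (c := c) (j := y' + 2) (by omega))
    omega
  have left_lt {i : ℕ} (hs : S.Seg c [1] i) (hi : k < i) : S.W c y < 3 := by
    by_contra! ha
    obtain ⟨j, hj, hz⟩ := seg_zero_zero_pred_of_three_le_W ha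
    have := hS.pair_gaps [1] [0, 0] (by decide) hs hz
    simp only [List.length_cons, List.length_nil] at this
    omega
  have right_lt {i : ℕ} (hs : S.Seg c [1] i) (hi : i + 1 < S.F c (y' + 2)) :
      S.W c (y' + 2) < 3 := by
    by_contra! hb
    have := hS.pair_gaps [1] [0, 0] (by decide) hs (seg_zero_zero_of_three_le_W hb)
    simp only [List.length_cons, List.length_nil] at this
    omega
  have four (a u v b : ℤ) (hy : y' = y + 1) (ha : S.W c y = a) (hu : S.W c (y + 1) = u)
      (hv : S.W c (y + 2) = v) (hb : S.W c (y + 3) = b)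
      (hp : ∃ p, (p ∈ badPatterns ∨ p.reverse ∈ badPatterns) ∧ p.map Prod.fst = [a, u, v, b]) :
      ∃ ws, S.ReadsBadPattern c y ws ∧ y + ws.length = y' + 3 :=
    ⟨[a, u, v, b], ⟨⟨ha, hu, hv, hb, trivial⟩, hp⟩, by simp [hy]⟩
  have five (a u v w b : ℤ) (hy : y' = y + 2) (ha : S.W c y = a) (hu : S.W c (y + 1) = u)
      (hv : S.W c (y + 2) = v) (hw : S.W c (y + 3) = w) (hb : S.W c (y + 4) = b)
      (hp : ∃ p, (p ∈ badPatterns ∨ p.reverse ∈ badPatterns) ∧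
        p.map Prod.fst = [a, u, v, w, b]) :
      ∃ ws, S.ReadsBadPattern c y ws ∧ y + ws.length = y' + 3 :=
    ⟨[a, u, v, w, b], ⟨⟨ha, hu, hv, hw, hb, trivial⟩, hp⟩, by simp [hy]⟩
  have p0 := S.pos_succ c k
  have p1 := S.pos_succ c (k + 1)
  simp only [Nat.add_assoc, Nat.reduceAdd] at *
  rcases hcases with ⟨hx, hs⟩ | ⟨hx, hs⟩ | ⟨hx, hs⟩ <;>
  rcases hcases' with ⟨hx', hs'⟩ | ⟨hx', hs'⟩ | ⟨hx', hs'⟩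
  · have hk1 : k' = k + 1 := by
      have := hS.pair_gaps [2] [2] (by decide) hs hs'
      simp only [List.length_cons, List.length_nil] at this
      omega
    rw [seg_singleton] at hs hs'
    subst hk1
    obtain rfl : y' = y + 2 := by omega
    simp only [Nat.add_assoc, Nat.reduceAdd] at *
    have ha3 : S.W c y < 3 := by
      by_contra! ha
      obtain ⟨i, hi, hz, hz', -⟩ := seg_zero_zero_pred_of_three_le_W ha
      obtain rfl : k = i + 2 := by omega
      exact (hS.path [2, 2, 0, 0] (by decide) c i).2 ⟨hz, hz', hs, hs', trivial⟩
    have hb3 : S.W c (y + 4) < 3 := by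
      by_contra! hb
      have hz := seg_zero_zero_of_three_le_W hb
      rw [show S.F c (y + 4) = k + 2 by omega] at hz
      exact (hS.path [2, 2, 0, 0] (by decide) c k).1 ⟨hs, hs', hz⟩
    obtain ha | ha : S.W c y = 1 ∨ S.W c y = 2 := by omega
    · obtain hb | hb : S.W c (y + 4) = 1 ∨ S.W c (y + 4) = 2 := by omega
      · exact five 1 0 1 0 1 trivial ha hx (by omega) hx' hb
          ⟨[(1, false), (0, true), (1, false), (0, true), (1, false)], by decide, rfl⟩
      · exact five 1 0 1 0 2 trivial ha hx (by omega) hx' hb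
          ⟨[(1, false), (0, true), (1, false), (0, true), (2, false)], by decide, rfl⟩
    · exact five 2 0 1 0 1 trivial ha hx (by omega) hx' (by omega)
        ⟨[(2, false), (0, true), (1, false), (0, true), (1, false)], by decide, rfl⟩
  · have hk1 : k' = k + 1 := by
      have := hS.pair_gaps [2] [1, 1] (by decide) hs hs'
      simp only [List.length_cons, List.length_nil] at this
      omega
    rw [seg_singleton] at hs
    subst hk1
    obtain rfl : y' = y + 2 := by omega
    simp only [Nat.add_assoc, Nat.reduceAdd] at *
    have ha := left_one (by decide) hs' (by omega)
    have hb3 := right_lt (seg_singleton.2 hs'.1) (by omega)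
    obtain hb | hb : S.W c (y + 4) = 1 ∨ S.W c (y + 4) = 2 := by omega
    · exact five 1 0 1 1 1 trivial ha hx (by omega) hx' hb
        ⟨[(1, false), (0, true), (1, false), (1, true), (1, false)], by decide, rfl⟩
    · exact five 1 0 1 1 2 trivial ha hx (by omega) hx' hb
        ⟨[(1, false), (0, true), (1, false), (1, true), (2, false)], by decide, rfl⟩
  · have hk1 : k' = k + 1 := by
      have := hS.pair_gaps [2] [1, 0, 1] (by decide) hs hs'
      simp only [List.length_cons, List.length_nil] at this
      omega
    subst hk1
    exact absurd ⟨hs.1, hs'.1, hs'.2.1, trivial⟩ (hS.path [2, 1, 0] (by decide) c k).1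
  · have hk1 : k' = k + 2 := by
      have := hS.pair_gaps [2] [1, 1] (by decide) hs' hs
      simp only [List.length_cons, List.length_nil] at this
      by_contra hne
      obtain rfl : k' = k + 1 := by omega
      have h1 := hs.2.1.2
      have h2 := hs'.1.2
      omega
    obtain ⟨q0, q1, -⟩ := id hs
    subst hk1
    obtain rfl : y' = y + 2 := by omega
    simp only [Nat.add_assoc, Nat.reduceAdd] at *
    have hb := right_one (by decide) hs (by simp; omega)
    have ha3 := left_lt (seg_singleton.2 q1) (by omega)
    obtain ha | ha : S.W c y = 1 ∨ S.W c y = 2 := by omega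
    · exact five 1 1 1 0 1 trivial ha hx (by omega) hx' hb
        ⟨[(1, false), (1, true), (1, false), (0, true), (1, false)], by decide, rfl⟩
    · exact five 2 1 1 0 1 trivial ha hx (by omega) hx' hb
        ⟨[(2, false), (1, true), (1, false), (0, true), (1, false)], by decide, rfl⟩
  · have hk1 := hS.pair_gaps [1, 1] [1, 1] (by decide) hs hs'
    simp only [List.length_cons, List.length_nil] at hk1
    obtain ⟨q0, q1, -⟩ := id hs
    have ha := left_one (by decide) hs' hkk
    obtain rfl | rfl : k' = k + 1 ∨ k' = k + 2 := by omega
    · obtain rfl : y' = y + 1 := by omega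
      simp only [Nat.add_assoc, Nat.reduceAdd] at *
      have hb := right_one (by decide) hs (by simp; omega)
      exact four 1 1 1 1 trivial ha hx hx' hb
        ⟨[(1, false), (1, true), (1, true), (1, false)], by decide, rfl⟩
    · obtain rfl : y' = y + 2 := by omega
      simp only [Nat.add_assoc, Nat.reduceAdd] at *
      have hb := right_one (by decide) hs (by simp; omega)
      exact five 1 1 1 1 1 trivial ha hx (by omega) hx' hb
        ⟨[(1, false), (1, true), (1, true), (1, true), (1, false)], by decide, rfl⟩
  · have hk1 : k' = k + 1 := by
      have := hS.pair_gaps [1, 0, 1] [1] (by decide) hs' (seg_singleton.2 hs.1)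
      simp only [List.length_cons, List.length_nil] at this
      omega
    obtain ⟨q0, q1, -⟩ := id hs
    subst hk1
    obtain rfl : y' = y + 1 := by omega
    simp only [Nat.add_assoc, Nat.reduceAdd] at *
    have ha : ¬ 1 < S.W c y := fun ha => by
      have := (hS.eq_of_one_lt_W ha (by omega : 1 < S.W c (y + 2))).2
      omega
    have hb := right_one (by decide) hs (by simp; omega)
    exact four 1 1 2 1 trivial (by omega) hx hx' hb
      ⟨[(1, false), (1, true), (2, true), (1, false)], by decide, rfl⟩
  · have hk1 := hS.pair_gaps [2] [1, 0, 1] (by decide) hs' hs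
    simp only [List.length_cons, List.length_nil] at hk1
    obtain ⟨q0, q1, q2, -⟩ := id hs
    have q := (seg_singleton.1 hs').2
    obtain rfl | rfl | rfl : k' = k + 1 ∨ k' = k + 2 ∨ k' = k + 3 := by omega
    · omega
    · exact absurd q (by have := q2.2; simp only [Nat.add_assoc, Nat.reduceAdd] at *; omega)
    · exact absurd ⟨q1, q2, hs'.1, trivial⟩ (hS.path [2, 1, 0] (by decide) c (k + 1)).2
  · have hk1 := hS.pair_gaps [1, 0, 1] [1] (by decide) hs (seg_singleton.2 hs'.2.1)
    simp only [List.length_cons, List.length_nil] at hk1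
    obtain ⟨q0, q1, q2, -⟩ := id hs
    have q := hs'.1
    obtain rfl | rfl : k' = k + 1 ∨ k' = k + 2 := by omega
    · omega
    · obtain rfl : y' = y + 1 := by simp only [Nat.add_assoc, Nat.reduceAdd] at *; omega
      simp only [Nat.add_assoc, Nat.reduceAdd] at *
      have hb : ¬ 1 < S.W c (y + 3) := fun hb => by
        have := (hS.eq_of_one_lt_W hb (by omega : 1 < S.W c (y + 1))).2
        omega
      have ha := left_one (by decide) hs' (by omega)
      exact four 1 2 1 1 trivial ha hx hx' (by omega)
        ⟨[(1, false), (2, true), (1, true), (1, false)], by decide, rfl⟩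
  · have := hS.pair_gaps [0] [0] (by decide) (seg_singleton.2 hs.2.1) (seg_singleton.2 hs'.2.1)
    simp only [List.length_cons, List.length_nil] at this
    obtain rfl : k' = k + 1 := by omega
    have q := hs.2.1.2
    have q' := hs'.1.2
    omega

end MarkSystem

theorem ofList_adj {L : List (List ℤ)} {x y : (ofList L).V} : (ofList L).graph.Adj x y ↔
    x.1 = y.1 ∧ ((x.2 : ℕ) + 1 = y.2 ∨ (y.2 : ℕ) + 1 = x.2) :=
  Iff.rfl

theorem ofList_ext {L : List (List ℤ)} {x y : (ofList L).V} (h : x.1 = y.1)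
    (h' : (x.2 : ℕ) = y.2) : x = y := by
  obtain ⟨c, j⟩ := x
  obtain ⟨c', j'⟩ := y
  obtain rfl : c = c' := h
  obtain rfl : j = j' := Fin.ext h'
  rfl

theorem ofList_deg {L : List (List ℤ)} (x : (ofList L).V) :
    (ofList L).deg x = (if 0 < (x.2 : ℕ) then 1 else 0) +
      if (x.2 : ℕ) + 1 < (L.get x.1).length then 1 else 0 := by
  obtain ⟨c, j, hj⟩ := x
  have hinj : Set.InjOn (fun y : (ofList L).V => (y.2 : ℕ))
      ((ofList L).graph.neighborSet ⟨c, j, hj⟩) := by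
    intro y hy z hz h
    exact ofList_ext (hy.1.symm.trans hz.1) h
  have himage : (fun y : (ofList L).V => (y.2 : ℕ)) ''
      ((ofList L).graph.neighborSet ⟨c, j, hj⟩) =
      (({j - 1, j + 1} : Finset ℕ).filter fun t => t ≠ j ∧ t < (L.get c).length : Finset ℕ) := by
    ext t
    simp only [Set.mem_image, Finset.coe_filter, Finset.mem_insert, Finset.mem_singleton,
      Set.mem_ofPred_eq]
    constructor
    · rintro ⟨⟨c', y, hy⟩, ⟨hc, h⟩, rfl⟩
      obtain rfl : c = c' := hc
      simp only at h ⊢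
      omega
    · rintro ⟨h, hne, ht⟩
      exact ⟨⟨c, t, ht⟩, ⟨rfl, by simp only; omega⟩, rfl⟩
  change ((ofList L).graph.neighborSet _).ncard = _
  rw [← hinj.ncard_image, himage, Set.ncard_coe_finset,
    Finset.filter_insert, Finset.filter_singleton]
  simp only
  split_ifs <;> first | omega | simp

namespace Config

/-- A chain of consecutive vertices runs monotonically along one component. -/
theorem IsChain.monotone {L : List (List ℤ)} {m : ℕ} {v : ℕ → (ofList L).V}
    (h : (ofList L).IsChain m v) : ∃ (c : Fin L.length) (j : ℕ), (∀ i ≤ m, (v i).1 = c) ∧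
      ((∀ i ≤ m, ((v i).2 : ℕ) = j + i) ∨ ∀ i ≤ m, ((v i).2 : ℕ) = j + (m - i)) := by
  induction m with
  | zero => exact ⟨(v 0).1, (v 0).2, by simp, Or.inl (by simp)⟩
  | succ m ih =>
    obtain ⟨c, j, hc, hmono⟩ := ih
      ⟨fun i hi i' hi' => h.1 i (by omega) i' (by omega), fun i hi => h.2 i (by omega)⟩
    obtain ⟨hadj, hstep⟩ := h.2 m (by omega)
    have hc' : ∀ i ≤ m + 1, (v i).1 = c := by
      intro i hi
      rcases Nat.lt_or_ge m i with hlt | hge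
      · obtain rfl : i = m + 1 := by omega
        exact hadj.symm.trans (hc m le_rfl)
      · exact hc i hge
    have hne : m ≠ 0 → ((v (m + 1)).2 : ℕ) ≠ (v (m - 1)).2 := by
      intro hm heq
      have := h.1 (m + 1) le_rfl (m - 1) (by omega)
        (ofList_ext ((hc' _ le_rfl).trans (hc' _ (by omega)).symm) heq)
      omega
    refine ⟨c, ?_⟩
    rcases eq_or_ne m 0 with rfl | hm
    · rcases hstep with hs | hs
      · refine ⟨(v 0).2, hc', Or.inl fun i hi => ?_⟩
        obtain rfl | rfl : i = 0 ∨ i = 1 := by omega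
        · rfl
        · exact hs.symm
      · refine ⟨(v 1).2, hc', Or.inr fun i hi => ?_⟩
        obtain rfl | rfl : i = 0 ∨ i = 1 := by omega
        · exact hs.symm
        · rfl
    · have hne := hne hm
      rcases hmono with hup | hdown
      · refine ⟨j, hc', Or.inl fun i hi => ?_⟩
        have h1 := hup m le_rfl
        have h2 := hup (m - 1) (by omega)
        rcases Nat.lt_or_ge m i with hlt | hge
        · obtain rfl : i = m + 1 := by omega
          omega
        · exact hup i hge
      · have h1 := hdown m le_rfl
        have h2 := hdown (m - 1) (by omega)
        refine ⟨j - 1, hc', Or.inr fun i hi => ?_⟩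
        rcases Nat.lt_or_ge m i with hlt | hge
        · obtain rfl : i = m + 1 := by omega
          omega
        · have := hdown i hge
          omega

end Config

/-- The marks of `S` compute the adjusted weights of the configuration encoded by `D`. -/
structure MarkSystem.Models {D : List (List ℤ)} (S : MarkSystem (Fin D.length)) : Prop where
  length : ∀ c, S.pos c (S.n c) + 1 = (D.get c).length
  adjw : ∀ x : (ofList D).V, (ofList D).adjw x = S.W x.1 x.2

namespace MarkSystem.Models

variable {D : List (List ℤ)} {S : MarkSystem (Fin D.length)}

theorem lt_length_of_W_pos (hM : S.Models) {c : Fin D.length} {j : ℕ} (h : 0 < S.W c j) :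
    j < (D.get c).length := by
  rw [W] at h
  have hl := hM.length c
  have h1 := S.pos_lt_iff c (S.n c) le_rfl (D.get c).length
  have h2 := S.F_le c (j + 1)
  by_contra! hj
  have := F_mono (S := S) c hj
  omega

theorem isBad_iff (hM : S.Models) (x : (ofList D).V) :
    (ofList D).IsBad x ↔ ∃ y, (x.2 : ℕ) = y + 1 ∧ S.BadSucc x.1 y := by
  obtain ⟨c, j, hj⟩ := x
  constructor
  · rintro ⟨⟨c₁, u, hu⟩, ⟨c₂, v, hv⟩, hne, ⟨h1, h1'⟩, ⟨h2, h2'⟩, h3, h4⟩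
    obtain rfl : c = c₁ := h1
    obtain rfl : c = c₂ := h2
    replace h3 : 0 < S.W c u := lt_of_lt_of_eq h3 (hM.adjw _)
    replace h4 : 0 < S.W c v := lt_of_lt_of_eq h4 (hM.adjw _)
    change j + 1 = u ∨ u + 1 = j at h1'
    change j + 1 = v ∨ v + 1 = j at h2'
    have huv : u ≠ v := by rintro rfl; exact hne rfl
    rcases Nat.lt_or_ge u v with hlt | hge
    · obtain rfl : j = u + 1 := by omega
      obtain rfl : v = u + 2 := by omega
      exact ⟨u, rfl, h3, h4⟩
    · obtain rfl : j = v + 1 := by omega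
      obtain rfl : u = v + 2 := by omega
      exact ⟨v, rfl, h4, h3⟩
  · rintro ⟨y, hy, h1, h2⟩
    obtain rfl : j = y + 1 := hy
    have l1 := hM.lt_length_of_W_pos h1
    have l2 := hM.lt_length_of_W_pos h2
    refine ⟨⟨c, y, l1⟩, ⟨c, y + 2, l2⟩, ?_, ⟨rfl, Or.inr rfl⟩, ⟨rfl, Or.inl rfl⟩, ?_, ?_⟩
    · intro h
      have := congrArg (fun z : (ofList D).V => (z.2 : ℕ)) h
      simp at this
    · exact lt_of_lt_of_eq h1 (hM.adjw ⟨c, y, l1⟩).symm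
    · exact lt_of_lt_of_eq h2 (hM.adjw ⟨c, y + 2, l2⟩).symm

end MarkSystem.Models

/-- A configuration of paths is induced if its components can be placed on segments of the
components of `P`, read in either direction, so that no two of them touch. -/
theorem isInducedSubgraph_ofList {L P : List (List ℤ)} (c : Fin L.length → Fin P.length)
    (f : Fin L.length → ℕ → ℕ)
    (hget : ∀ i (t : ℕ) (ht : t < (L.get i).length),
      ∃ h : f i t < (P.get (c i)).length, (P.get (c i))[f i t] = (L.get i)[t])
    (hf : ∀ i, ∃ k, (∀ t < (L.get i).length, f i t = k + t) ∨
      ∀ t < (L.get i).length, f i t + t = k)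
    (hsep : ∀ i j, i ≠ j → c i = c j → ∀ s < (L.get i).length, ∀ t < (L.get j).length,
      f i s ≠ f j t ∧ f i s + 1 ≠ f j t ∧ f j t + 1 ≠ f i s) :
    IsInducedSubgraph (ofList L) (ofList P) := by
  have hlt : ∀ i (t : Fin (L.get i).length), f i t < (P.get (c i)).length :=
    fun i t => (hget i t t.2).1
  refine ⟨fun x => ⟨c x.1, f x.1 x.2, hlt x.1 x.2⟩, ?_, fun ⟨i, t⟩ => (hget i t t.2).2, ?_⟩
  · rintro ⟨i, s, hs⟩ ⟨j, t, ht⟩ h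
    have h1 : c i = c j := congrArg Sigma.fst h
    have h2 : f i s = f j t := congrArg (fun z : (ofList P).V => (z.2 : ℕ)) h
    rcases eq_or_ne i j with rfl | hne
    · refine ofList_ext rfl (?_ : s = t)
      obtain ⟨k, hk | hk⟩ := hf i <;>
      · have := hk s hs
        have := hk t ht
        omega
    · exact absurd h2 (hsep i j hne h1 s hs t ht).1
  · rintro ⟨i, s, hs⟩ ⟨j, t, ht⟩
    change (i = j ∧ (s + 1 = t ∨ t + 1 = s)) ↔
      (c i = c j ∧ (f i s + 1 = f j t ∨ f j t + 1 = f i s))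
    rcases eq_or_ne i j with rfl | hne
    · obtain ⟨k, hk | hk⟩ := hf i <;>
      · have := hk s hs
        have := hk t ht
        simp only [true_and]
        omega
    · refine iff_of_false (fun h => hne h.1) fun ⟨h1, h2⟩ => ?_
      have := hsep i j hne h1 s hs t ht
      omega

/-- A component of a plumbing graph with weights `a` induces marks on the dual path: consecutive
marks are `-2 - w` apart, `w` being the corresponding weight of `a`, and the number of marks at a
vertex is its adjusted weight. -/
theorem DualSeqs.exists_marks {a b : List ℤ} (h : DualSeqs (a.map fun x => -x) b) :
    ∃ gap pos F : ℕ → ℕ, (∀ k < a.length, pos (k + 1) = pos k + gap k) ∧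
      (∀ k ≤ a.length, ∀ j, pos k < j ↔ k < F j) ∧ (∀ j, F j ≤ a.length + 1) ∧
      pos a.length + 1 = b.length ∧
      (∀ j (h : j < b.length), b[j] = F (j + 1) - F j + (if 0 < j then 1 else 0) +
        (if j + 1 < b.length then 1 else 0)) ∧
      ∀ k (h : k < a.length), a[k] = -2 - (gap k : ℤ) := by
  have ha := h.2.2.1
  have hb := h.eq_dualGaps
  obtain ⟨pos, F, -, h1, h2, h3, h4, h5⟩ :=
    exists_marks_dualGaps ((a.map fun x => -x).map fun x => (x - 2).toNat)
  rw [← hb] at h4 h5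
  simp only [List.length_map] at h1 h2 h3 h4
  refine ⟨fun k => (-(a.getD k 0) - 2).toNat, pos, F, fun k hk => ?_, h2, h3, h4, h5,
    fun k hk => ?_⟩
  · have := h1 k hk
    simpa [hk] using this
  · have := ha (-a[k]) (List.mem_map_of_mem (List.getElem_mem hk))
    simp [hk]
    omega

/-- The gaps of `S` are read off from the weights `-2 - gap` of the configuration encoded
by `P`. -/
structure MarkSystem.Dualizes {ι : Type} (S : MarkSystem ι) (P : List (List ℤ))
    (e : ι → Fin P.length) : Prop where
  inj : Function.Injective e
  length : ∀ c, (P.get (e c)).length = S.n c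
  weight : ∀ c k (h : k < (P.get (e c)).length), (P.get (e c))[k] = -2 - (S.gap c k : ℤ)

theorem IsDualPair.exists_markSystem {P D : List (List ℤ)} (h : IsDualPair P D) :
    ∃ (S : MarkSystem (Fin D.length)) (e : Fin D.length → Fin P.length),
      S.Models ∧ S.Dualizes P e := by
  obtain ⟨hl, h⟩ := h
  choose gap pos F h1 h2 h3 h4 h5 h6 using fun c => (h (Fin.cast hl.symm c)).exists_marks
  refine ⟨⟨fun c => (P.get (Fin.cast hl.symm c)).length, gap, pos, F, h1, h2, h3⟩,
    Fin.cast hl.symm, ⟨h4, ?_⟩, ⟨Fin.cast_injective _, fun _ => rfl, h6⟩⟩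
  intro x
  have h7 : (ofList D).w x = F x.1 (x.2 + 1) - F x.1 x.2 + (if 0 < (x.2 : ℕ) then 1 else 0) +
    (if (x.2 : ℕ) + 1 < (D.get x.1).length then 1 else 0) := h5 x.1 x.2 x.2.2
  change _ = (F x.1 (x.2 + 1) : ℤ) - F x.1 x.2
  rw [Config.adjw, ofList_deg, h7]
  push_cast
  ring

theorem IsDualPair.two_le_w {P D : List (List ℤ)} (h : IsDualPair P D) (x : (ofList D).V) :
    2 ≤ (ofList D).w x := by
  obtain ⟨hl, h⟩ := h
  exact (h (Fin.cast hl.symm x.1)).2.2.2.1 _ (List.get_mem _ _)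

namespace MarkSystem

variable {ι : Type} {S : MarkSystem ι}

theorem Seg.getElem {c : ι} : ∀ {l : List ℕ} {k : ℕ}, S.Seg c l k →
    ∀ t (ht : t < l.length), k + t < S.n c ∧ S.gap c (k + t) = l[t]
  | [], _, _, t, ht => by simp at ht
  | d :: l, k, h, 0, _ => h.1
  | d :: l, k, h, t + 1, ht => by
    have := h.2.getElem t (by simpa using ht)
    rwa [show k + (t + 1) = k + 1 + t by omega]

theorem Reads.getD {c : ι} : ∀ {l : List ℤ} {j : ℕ}, S.Reads c l j →
    ∀ i < l.length, S.W c (j + i) = l.getD i 0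
  | [], _, _, i, hi => by simp at hi
  | x :: l, j, h, 0, _ => h.1
  | x :: l, j, h, i + 1, hi => by
    have := h.2.getD i (by simpa using hi)
    rw [show j + (i + 1) = j + 1 + i by omega, this]
    rfl

theorem reads_of_getD {c : ι} : ∀ {l : List ℤ} {j : ℕ},
    (∀ i < l.length, S.W c (j + i) = l.getD i 0) → S.Reads c l j
  | [], _, _ => trivial
  | x :: l, j, h => by
    refine ⟨h 0 (by simp), reads_of_getD fun i hi => ?_⟩
    have := h (i + 1) (by simpa using hi)
    rwa [show j + (i + 1) = j + 1 + i by omega] at this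

theorem Dualizes.getElem {P : List (List ℤ)} {e : ι → Fin P.length} (hS : S.Dualizes P e)
    {c : ι} {k d : ℕ} (h : k < S.n c ∧ S.gap c k = d) :
    ∃ h : k < (P.get (e c)).length, (P.get (e c))[k] = -2 - (d : ℤ) := by
  obtain ⟨hk, rfl⟩ := h
  exact ⟨(hS.length c).symm ▸ hk, hS.weight c k _⟩

theorem Dualizes.admissible {P : List (List ℤ)} {e : ι → Fin P.length} (hS : S.Dualizes P e)
    (h17 : ∀ F ∈ forbidden17, ¬ IsInducedSubgraph (ofList F) (ofList P)) :
    S.Admissible := by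
  constructor
  · refine fun l hl c k => ⟨fun h => h17 _ hl ?_, fun h => h17 _ hl ?_⟩
    · refine isInducedSubgraph_ofList (fun _ => e c) (fun _ t => k + t) ?_
        (fun _ => ⟨k, Or.inl fun _ _ => rfl⟩) fun i j hij =>
          absurd (Subsingleton.elim (α := Fin 1) i j) hij
      intro i t ht
      obtain rfl : i = ⟨0, Nat.zero_lt_one⟩ := Subsingleton.elim (α := Fin 1) _ _
      have ht' : t < l.length := by simpa using ht
      simpa using hS.getElem (h.getElem t ht')
    · refine isInducedSubgraph_ofList (fun _ => e c) (fun _ t => k + (l.length - 1 - t)) ?_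
        (fun _ => ⟨k + (l.length - 1), Or.inr fun t ht => ?_⟩) fun i j hij =>
          absurd (Subsingleton.elim (α := Fin 1) i j) hij
      · intro i t ht
        obtain rfl : i = ⟨0, Nat.zero_lt_one⟩ := Subsingleton.elim (α := Fin 1) _ _
        have ht' : t < l.length := by simpa using ht
        have := h.getElem (l.length - 1 - t) (by simp; omega)
        rw [List.getElem_reverse] at this
        simp only [show l.length - 1 - (l.length - 1 - t) = t by omega] at this
        simpa using hS.getElem this
      · have ht' : t < l.length := by
          rename_i i
          obtain rfl : i = ⟨0, Nat.zero_lt_one⟩ := Subsingleton.elim (α := Fin 1) _ _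
          simpa using ht
        omega
  · intro l l' hl c c' k k' h h'
    by_contra hsep
    have hsep : e c = e c' → k + l.length < k' ∨ k' + l'.length < k := by
      intro he
      have := hS.inj he
      by_contra! hlt
      exact hsep ⟨this, hlt⟩
    refine h17 _ hl (isInducedSubgraph_ofList (fun i : Fin 2 => if i = 0 then e c else e c')
      (fun (i : Fin 2) t => if i = 0 then k + t else k' + t) ?_ ?_ ?_)
    · refine Fin.forall_fin_two.2 ⟨fun t ht => ?_, fun t ht => ?_⟩
      · have ht' : t < l.length := by simpa using ht
        simpa using hS.getElem (h.getElem t ht')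
      · have ht' : t < l'.length := by simpa using ht
        simpa using hS.getElem (h'.getElem t ht')
    · exact Fin.forall_fin_two.2 ⟨⟨k, Or.inl fun _ _ => rfl⟩, ⟨k', Or.inl fun _ _ => rfl⟩⟩
    · refine Fin.forall_fin_two.2 ⟨Fin.forall_fin_two.2 ⟨fun hne => absurd rfl hne, ?_⟩,
        Fin.forall_fin_two.2 ⟨?_, fun hne => absurd rfl hne⟩⟩
      · intro _ he s hs t ht
        have hs' : s < l.length := by simpa using hs
        have ht' : t < l'.length := by simpa using ht
        have := hsep (by simpa using he)
        simp
        omega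
      · intro _ he s hs t ht
        have hs' : s < l'.length := by simpa using hs
        have ht' : t < l.length := by simpa using ht
        have := hsep (by simpa using he.symm)
        simp
        omega

end MarkSystem
namespace MarkSystem

theorem badPatterns_flag : ∀ q ∈ badPatterns, 3 ≤ q.length ∧ ∀ i < q.length,
    ((q.getD i (0, false)).2 = true ↔ 0 < i ∧ i + 1 < q.length ∧
      0 < (q.getD (i - 1) (0, false)).1 ∧ 0 < (q.getD (i + 1) (0, false)).1) := by
  decide

variable {D : List (List ℤ)} {S : MarkSystem (Fin D.length)}

theorem Models.isBadPartChain (hM : S.Models) {c : Fin D.length} {y y' m : ℕ}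
    (hm : y + m = y' + 2) (hy : S.BadSucc c y') (σ : ℕ → ℕ)
    (hσ : (∀ i, σ i = y + i) ∨ ∀ i, σ i = y + (m - i)) {q : List (ℤ × Bool)}
    (hq : q ∈ badPatterns) (hqm : m + 1 = q.length)
    (hW : ∀ i < q.length, S.W c (σ i) = (q.getD i (0, false)).1)
    (hbad : ∀ c' z, S.BadSucc c' z → c' = c ∧ y ≤ z ∧ z ≤ y') :
    ∃ m v, (ofList D).IsBadPartChain q m v := by
  have hlast := hM.lt_length_of_W_pos hy.2
  obtain ⟨hq3, hflag⟩ := badPatterns_flag q hq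
  let v : ℕ → (ofList D).V := fun i => ⟨c, min (σ i) (y' + 2), by
    have := min_le_right (σ i) (y' + 2)
    omega⟩
  have hv : ∀ i ≤ m, ((v i).2 : ℕ) = σ i := by
    intro i hi
    refine min_eq_left ?_
    rcases hσ with h | h <;> · have := h i; omega
  have hinj : ∀ i ≤ m, ∀ j ≤ m, σ i = σ j → i = j := by
    intro i hi j hj h
    rcases hσ with hs | hs <;> · have := hs i; have := hs j; omega
  have hadjw : ∀ i ≤ m, (ofList D).adjw (v i) = (q.getD i (0, false)).1 := by
    intro i hi
    rw [hM.adjw, hv i hi]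
    exact hW i (by omega)
  have hbad_iff : ∀ i < q.length, (q.getD i (0, false)).2 = true ↔
      ∃ z, σ i = z + 1 ∧ S.BadSucc c z := by
    intro i hi
    rw [hflag i hi]
    constructor
    · rintro ⟨h1, h2, h3, h4⟩
      rw [← hW (i - 1) (by omega)] at h3
      rw [← hW (i + 1) (by omega)] at h4
      rcases hσ with hs | hs
      · refine ⟨σ (i - 1), ?_, h3, ?_⟩
        · rw [hs, hs]; omega
        · convert h4 using 2
          rw [hs, hs]; omega
      · refine ⟨σ (i + 1), ?_, h4, ?_⟩
        · rw [hs, hs]; omega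
        · convert h3 using 2
          rw [hs, hs]; omega
    · rintro ⟨z, hz, hb⟩
      obtain ⟨-, hz1, hz2⟩ := hbad c z hb
      have hi0 : 0 < i ∧ i + 1 < q.length := by
        rcases hσ with hs | hs <;> · have := hs i; omega
      refine ⟨hi0.1, hi0.2, ?_⟩
      rw [← hW (i - 1) (by omega), ← hW (i + 1) (by omega)]
      rcases hσ with hs | hs
      · rw [show σ (i - 1) = z by rw [hs] at hz ⊢; omega,
          show σ (i + 1) = z + 2 by rw [hs] at hz ⊢; omega]
        exact hb
      · rw [show σ (i - 1) = z + 2 by rw [hs] at hz ⊢; omega,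
          show σ (i + 1) = z by rw [hs] at hz ⊢; omega]
        exact hb.symm
  refine ⟨m, v, ⟨fun i hi j hj h => ?_, fun i hi => ?_⟩, hqm, fun i => ?_, fun x => ?_⟩
  · have := congrArg (fun z : (ofList D).V => (z.2 : ℕ)) h
    simp only [hv i hi, hv j hj] at this
    exact hinj i hi j hj this
  · refine ⟨rfl, ?_⟩
    rw [hv i hi.le, hv (i + 1) hi]
    rcases hσ with hs | hs <;> · have := hs i; have := hs (i + 1); omega
  · rw [hadjw i (by omega), List.getD_eq_getElem _ _ i.2]
    rfl
  · rw [hM.isBad_iff]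
    constructor
    · rintro ⟨z, hz, hb⟩
      obtain ⟨hc, hz1, hz2⟩ := hbad _ _ hb
      obtain ⟨i, hi, hiz⟩ : ∃ i ≤ m, σ i = z + 1 := by
        rcases hσ with hs | hs
        · exact ⟨z + 1 - y, by omega, by rw [hs]; omega⟩
        · exact ⟨y + m - (z + 1), by omega, by rw [hs]; omega⟩
      refine ⟨⟨i, by omega⟩, ?_, ofList_ext hc.symm ((hv i hi).trans (hiz.trans hz.symm))⟩
      have := (hbad_iff i (by omega)).2 ⟨z, hiz, hc ▸ hb⟩
      rwa [List.getD_eq_getElem _ _ (by omega)] at this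
    · rintro ⟨i, hi, rfl⟩
      rw [hv i (by omega)]
      exact (hbad_iff i i.2).1 (by rwa [List.getD_eq_getElem _ _ i.2])

theorem Models.exists_isBadPartChain (hM : S.Models) (hS : S.Admissible) {c : Fin D.length}
    {z : ℕ} (hz : S.BadSucc c z) :
    ∃ p ∈ badPatterns, ∃ m v, (ofList D).IsBadPartChain p m v := by
  set Z : Set ℕ := {z | S.BadSucc c z}
  have hne : Z.Nonempty := ⟨z, hz⟩
  have hbdd : BddAbove Z :=
    ⟨(D.get c).length, fun z (hz : S.BadSucc c z) => (hM.lt_length_of_W_pos hz.1).le⟩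
  have hbad : ∀ c' z, S.BadSucc c' z → c' = c ∧ sInf Z ≤ z ∧ z ≤ sSup Z := by
    intro c' z' hz'
    obtain rfl := hS.eq_of_bad hz' hz
    exact ⟨rfl, Nat.sInf_le hz', le_csSup hbdd hz'⟩
  have hy : S.BadSucc c (sInf Z) := Nat.sInf_mem hne
  have hy' : S.BadSucc c (sSup Z) := Nat.sSup_mem hne hbdd
  obtain ⟨ws, ⟨hr, p, hp, hpw⟩, hlen⟩ : ∃ ws, S.ReadsBadPattern c (sInf Z) ws ∧
      sInf Z + ws.length = sSup Z + 3 := by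
    rcases (hbad c _ hy).2.2.eq_or_lt with h | h
    · obtain ⟨ws, h1, h2⟩ := hS.exists_readsBadPattern_of_bad hy
      exact ⟨ws, h1, by omega⟩
    · exact hS.exists_readsBadPattern_of_bad_bad hy hy' h
  have hpl : p.length = ws.length := by rw [← hpw, List.length_map]
  have hpW : ∀ i < ws.length, S.W c (sInf Z + i) = (p.getD i (0, false)).1 := by
    intro i hi
    rw [hr.getD i hi, ← hpw, List.getD_eq_getElem _ _ (by simpa [hpl] using hi),
      List.getD_eq_getElem _ _ (by omega), List.getElem_map]
  rcases hp with hp | hp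
  · have h3 := (badPatterns_flag p hp).1
    exact ⟨p, hp, hM.isBadPartChain (m := ws.length - 1) (by omega) hy' _ (Or.inl fun _ => rfl) hp
      (by omega) (fun i hi => hpW i (by omega)) hbad⟩
  · have h3 := (badPatterns_flag _ hp).1
    rw [List.length_reverse] at h3
    refine ⟨p.reverse, hp, hM.isBadPartChain (m := ws.length - 1) (by omega) hy' _
      (Or.inr fun _ => rfl) hp (by simp; omega) (fun i hi => ?_) hbad⟩
    rw [List.length_reverse] at hi
    rw [hpW _ (by omega), List.getD_eq_getElem _ _ (by omega),
      List.getD_eq_getElem _ _ (by simpa using hi), List.getElem_reverse]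
    simp only [hpl]

theorem Models.not_hasPattern (hM : S.Models) (hS : S.Admissible) {p : List ℤ}
    (hp : p ∈ forbiddenPatterns) : ¬ (ofList D).HasPattern p := by
  rintro ⟨m, v, hchain, hm, hW⟩
  obtain ⟨c, j, hc, hmono⟩ := hchain.monotone
  have hW' : ∀ i ≤ m, S.W c ((v i).2 : ℕ) = p.getD i 0 := by
    intro i hi
    rw [List.getD_eq_getElem _ _ (by omega)]
    exact (congrArg (fun c => S.W c ((v i).2 : ℕ)) (hc i hi)).symm.trans
      ((hM.adjw (v i)).symm.trans (hW ⟨i, by omega⟩))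
  rcases hmono with h | h
  · refine (hS.not_reads_forbiddenPatterns hp c j).1 (reads_of_getD fun i hi => ?_)
    rw [← h i (by omega), hW' i (by omega)]
  · refine (hS.not_reads_forbiddenPatterns hp c j).2 (reads_of_getD fun i hi => ?_)
    rw [List.length_reverse] at hi
    have h1 := h (m - i) (by omega)
    rw [show m - (m - i) = i by omega] at h1
    rw [← h1, hW' _ (by omega), List.getD_eq_getElem _ _ (by omega),
      List.getD_eq_getElem _ _ (by simpa using hi), List.getElem_reverse]
    congr 1
    omega

theorem Models.workingConditions (hM : S.Models) (hS : S.Admissible)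
    (hD : ∀ x, 2 ≤ (ofList D).w x) : (ofList D).WorkingConditions := by
  refine ⟨hD, fun x => ?_, fun x x' h h' => ?_, fun v x hv hx hx1 => ?_, ?_,
    fun u v x huv hu hv hx hx2 => ?_, fun p hp => hM.not_hasPattern hS hp, ?_⟩
  · rw [hM.adjw]
    exact hS.W_le_three _ _
  · rw [hM.adjw] at h h'
    obtain ⟨h1, h2⟩ := hS.eq_of_one_lt_W h h'
    exact ofList_ext h1 h2
  · obtain ⟨y, hy, hb⟩ := (hM.isBad_iff x).1 hx
    rw [hM.adjw] at hv hx1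
    rw [hy] at hx1
    obtain ⟨h1, h2⟩ := hS.adj_of_one_lt_W_of_bad hv hb hx1
    exact ofList_adj.2 ⟨h1.symm, by omega⟩
  · rintro ⟨v, hv⟩ u u' ⟨hc, huu⟩ hu hu'
    rw [hM.adjw] at hv hu hu'
    rcases huu with h | h
    · exact hS.not_adj_ones hv hu (by rwa [h, hc])
    · exact hS.not_adj_ones hv hu' (by rwa [h, ← hc])
  · obtain ⟨y, hy, hb⟩ := (hM.isBad_iff x).1 hx
    obtain ⟨hc, huv⟩ := huv
    rw [hM.adjw] at hu hv hx2
    rw [hy] at hx2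
    simp only [ofList_adj]
    rcases huv with h | h
    · obtain ⟨h1, h2⟩ := hS.adj_of_bad_two hu (by rwa [h, hc]) hb hx2
      rcases h2 with h2 | h2
      · exact Or.inr ⟨h1.symm.trans hc, by omega⟩
      · exact Or.inl ⟨h1.symm, by omega⟩
    · obtain ⟨h1, h2⟩ := hS.adj_of_bad_two hv (by rwa [h, ← hc]) hb hx2
      rcases h2 with h2 | h2
      · exact Or.inl ⟨h1.symm.trans hc.symm, by omega⟩
      · exact Or.inr ⟨h1.symm, by omega⟩
  · rintro ⟨x, hx⟩
    obtain ⟨y, -, hb⟩ := (hM.isBad_iff x).1 hx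
    exact hM.exists_isBadPartChain hS hb

end MarkSystem

/-- Lemma 3.6: if the canonical plumbing graph contains none of the seventeen forbidden
configurations as an induced subgraph, then its dual satisfies the Working Conditions. -/
theorem statement1 (P D : List (List ℤ)) (hdual : IsDualPair P D)
    (h17 : ∀ F ∈ forbidden17, ¬ IsInducedSubgraph (ofList F) (ofList P)) :
    (ofList D).WorkingConditions := by
  obtain ⟨S, e, hM, hS⟩ := hdual.exists_markSystem
  exact hM.workingConditions (hS.admissible h17) hdual.two_le_w

end LensPaper
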